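/- (Gram's formula) For every real x > 1, the Gram series 1 + Σ_{n=1}^∞ (log x)^n / (n · ζ(n+1) · n!) equals lim_{N→∞} Σ_{n=1}^N (μ(n)/n) · li(x^{1/n}), where μ is the Möbius function and li(x^{1/n}) = γ + log((log x)/n) + Σ_{k=1}^∞ ((log x)/n)^k / (k · k!) is the logarithmic integral of x^{1/n} expressed by its convergent series; in particular the Gram series and the stated limit both exist. -/

import Mathlib

open Filter ArithmeticFunction

/-- The summands of a series for `(s - 1) * ζ s - 1` that converges for `0 < s.re`. -/
noncomputable def zetaTerm (s : ℂ) (n : ℕ) : ℂ :=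
  (s - 1) * ((n + 1 : ℝ) : ℂ) ^ (-s) +
    (((n + 2 : ℝ) : ℂ) ^ (1 - s) - ((n + 1 : ℝ) : ℂ) ^ (1 - s))

lemma norm_ofReal_cpow_neg_sub_le {a u : ℝ} (ha : 1 ≤ a) (hu : u ∈ Set.Icc a (a + 1)) {s : ℂ}
    (hs : 0 < s.re) : ‖(u : ℂ) ^ (-s) - (a : ℂ) ^ (-s)‖ ≤ ‖s‖ * a ^ (-s.re - 1) := by
  have h := Convex.norm_image_sub_le_of_norm_hasDerivWithin_le (f := fun x : ℝ => (x : ℂ) ^ (-s))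
    (f' := fun x : ℝ => -s * (x : ℂ) ^ (-s - 1)) (s := Set.Icc a (a + 1)) (x := a) (y := u)
    (C := ‖s‖ * a ^ (-s.re - 1)) ?_ ?_ (convex_Icc _ _) ⟨le_rfl, by linarith⟩ hu
  · refine h.trans ?_
    have h1 : ‖u - a‖ ≤ 1 := by
      rw [Real.norm_eq_abs, abs_le]; constructor <;> linarith [hu.1, hu.2]
    have h2 : 0 ≤ ‖s‖ * a ^ (-s.re - 1) := by positivity
    nlinarith
  · intro x hx
    have hx0 : x ≠ 0 := by linarith [hx.1]
    have hs0 : -s ≠ 0 := by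
      intro h0; have := congrArg Complex.re h0; simp at this; linarith
    exact (hasDerivAt_ofReal_cpow_const hx0 hs0).hasDerivWithinAt
  · intro x hx
    have hx0 : 0 < x := by linarith [hx.1]
    rw [norm_mul, norm_neg, Complex.norm_cpow_eq_rpow_re_of_pos hx0]
    simp only [Complex.sub_re, Complex.neg_re, Complex.one_re]
    gcongr ‖s‖ * ?_
    exact Real.rpow_le_rpow_of_nonpos (by linarith) hx.1 (by linarith)

lemma norm_ofReal_cpow_neg_sub_le_two {a u : ℝ} (ha : 1 ≤ a) (hu : a ≤ u) {s : ℂ}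
    (hs : 0 < s.re) : ‖(u : ℂ) ^ (-s) - (a : ℂ) ^ (-s)‖ ≤ 2 * a ^ (-s.re) := by
  refine (norm_sub_le _ _).trans ?_
  rw [Complex.norm_cpow_eq_rpow_re_of_pos (by linarith),
    Complex.norm_cpow_eq_rpow_re_of_pos (by linarith), Complex.neg_re, two_mul]
  gcongr ?_ + _
  exact Real.rpow_le_rpow_of_nonpos (by linarith) hu (by linarith)

lemma norm_ofReal_cpow_neg_sub_le_rpow {a u θ : ℝ} (ha : 1 ≤ a) (hu : u ∈ Set.Icc a (a + 1))
    {s : ℂ} (hs : 0 < s.re) (h0 : 0 ≤ θ) (h1 : θ ≤ 1) :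
    ‖(u : ℂ) ^ (-s) - (a : ℂ) ^ (-s)‖ ≤ 2 * ‖s‖ ^ θ * a ^ (-s.re - θ) := by
  have ha0 : 0 < a := by linarith
  have hs0 : 0 < ‖s‖ := hs.trans_le ((le_abs_self _).trans (Complex.abs_re_le_norm s))
  have key : 2 * ‖s‖ ^ θ * a ^ (-s.re - θ) = 2 * (‖s‖ / a) ^ θ * a ^ (-s.re) := by
    rw [Real.rpow_sub ha0, Real.div_rpow hs0.le ha0.le]; ring
  rw [key]
  rcases le_total 1 (‖s‖ / a) with h | h
  · refine (norm_ofReal_cpow_neg_sub_le_two ha hu.1 hs).trans ?_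
    gcongr
    have := Real.one_le_rpow h h0
    linarith
  · refine (norm_ofReal_cpow_neg_sub_le ha hu hs).trans ?_
    have e : ‖s‖ * a ^ (-s.re - 1) = (‖s‖ / a) * a ^ (-s.re) := by
      rw [Real.rpow_sub ha0, Real.rpow_one]; ring
    rw [e]
    gcongr
    have : (‖s‖ / a) ^ (1 : ℝ) ≤ (‖s‖ / a) ^ θ :=
      Real.rpow_le_rpow_of_exponent_ge (by positivity) h h1
    rw [Real.rpow_one] at this
    have h3 : 0 ≤ (‖s‖ / a) ^ θ := by positivity
    linarith

lemma norm_zetaTerm_le {θ : ℝ} (h0 : 0 ≤ θ) (h1 : θ ≤ 1) {s : ℂ} (hs : 0 < s.re) (n : ℕ) :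
    ‖zetaTerm s n‖ ≤ ‖s - 1‖ * (2 * ‖s‖ ^ θ * (n + 1 : ℝ) ^ (-s.re - θ)) := by
  rcases eq_or_ne s 1 with rfl | hs1
  · simp [zetaTerm]
  set a : ℝ := n + 1 with ha_def
  have ha : 1 ≤ a := by simp [ha_def]
  have h := Convex.norm_image_sub_le_of_norm_hasDerivWithin_le
    (f := fun x : ℝ => (s - 1) * (a : ℂ) ^ (-s) * (x : ℂ) + (x : ℂ) ^ (1 - s))
    (f' := fun x : ℝ => (s - 1) * (a : ℂ) ^ (-s) * 1 + (1 - s) * (x : ℂ) ^ (1 - s - 1))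
    (s := Set.Icc a (a + 1)) (x := a) (y := a + 1)
    (C := ‖s - 1‖ * (2 * ‖s‖ ^ θ * a ^ (-s.re - θ))) ?_ ?_ (convex_Icc _ _)
    ⟨le_rfl, by linarith⟩ ⟨by linarith, le_rfl⟩
  · have e : zetaTerm s n = (s - 1) * (a : ℂ) ^ (-s) * ((a + 1 : ℝ) : ℂ) + ((a + 1 : ℝ) : ℂ) ^ (1 - s)
        - ((s - 1) * (a : ℂ) ^ (-s) * (a : ℂ) + (a : ℂ) ^ (1 - s)) := by
      have : ((n + 2 : ℝ) : ℂ) = ((a + 1 : ℝ) : ℂ) := by rw [ha_def]; push_cast; ring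
      rw [zetaTerm, this, ← ha_def]; push_cast; ring
    rw [e]
    refine h.trans ?_
    simp
  · intro x hx
    have hx0 : x ≠ 0 := by linarith [hx.1]
    have hs0 : 1 - s ≠ 0 := sub_ne_zero.mpr hs1.symm
    have hid : HasDerivAt (fun x : ℝ => (x : ℂ)) 1 x := Complex.ofRealCLM.hasDerivAt
    exact ((hid.const_mul _).add (hasDerivAt_ofReal_cpow_const hx0 hs0)).hasDerivWithinAt
  · intro x hx
    have e : (s - 1) * (a : ℂ) ^ (-s) * 1 + (1 - s) * (x : ℂ) ^ (1 - s - 1) =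
        -(s - 1) * ((x : ℂ) ^ (-s) - (a : ℂ) ^ (-s)) := by
      rw [show 1 - s - 1 = -s by ring]; ring
    rw [e, norm_mul, norm_neg]
    gcongr
    exact norm_ofReal_cpow_neg_sub_le_rpow ha hx hs h0 h1

lemma hasSum_zetaTerm_of_one_lt_re {s : ℂ} (hs : 1 < s.re) :
    HasSum (zetaTerm s) (riemannZeta₁ s - 1) := by
  have hs1 : s ≠ 1 := by rintro rfl; simp at hs
  have h1 : HasSum (fun n : ℕ => (s - 1) * ((n + 1 : ℝ) : ℂ) ^ (-s)) ((s - 1) * riemannZeta s) := by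
    refine HasSum.mul_left _ ?_
    rw [zeta_eq_tsum_one_div_nat_add_one_cpow hs]
    have hsum : Summable (fun n : ℕ => 1 / (n + 1 : ℂ) ^ s) := by
      have := (summable_nat_add_iff 1).mpr (Complex.summable_one_div_nat_cpow.mpr hs)
      simpa using this
    have e : (fun n : ℕ => ((n + 1 : ℝ) : ℂ) ^ (-s)) = fun n : ℕ => 1 / (n + 1 : ℂ) ^ s := by
      funext n
      rw [Complex.cpow_neg]; push_cast; simp
    rw [e]
    exact hsum.hasSum
  have h2 : HasSum (fun n : ℕ => ((n + 2 : ℝ) : ℂ) ^ (1 - s) - ((n + 1 : ℝ) : ℂ) ^ (1 - s)) (0 - 1) := by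
    have hsum : Summable (fun n : ℕ => ((n + 2 : ℝ) : ℂ) ^ (1 - s) - ((n + 1 : ℝ) : ℂ) ^ (1 - s)) := by
      have hz : Summable (zetaTerm s) := by
        refine Summable.of_norm_bounded
          (g := fun n : ℕ => ‖s - 1‖ * (2 * ‖s‖ ^ (0 : ℝ) * (n + 1 : ℝ) ^ (-s.re - 0))) ?_
          (fun n => norm_zetaTerm_le le_rfl zero_le_one (by linarith) n)
        have := (summable_nat_add_iff 1).mpr (Real.summable_nat_rpow (p := -s.re) |>.mpr (by linarith))
        simpa using (this.mul_left 2).mul_left ‖s - 1‖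
      refine (hz.sub h1.summable).congr fun n => ?_
      simp [zetaTerm]
    rw [hsum.hasSum_iff_tendsto_nat]
    have : ∀ N : ℕ, ∑ n ∈ Finset.range N, (((n + 2 : ℝ) : ℂ) ^ (1 - s) - ((n + 1 : ℝ) : ℂ) ^ (1 - s))
        = ((N + 1 : ℝ) : ℂ) ^ (1 - s) - 1 := by
      intro N
      have := Finset.sum_range_sub (fun n : ℕ => ((n + 1 : ℝ) : ℂ) ^ (1 - s)) N
      simp only [Nat.cast_zero, zero_add, Complex.ofReal_one, Complex.one_cpow] at this
      rw [← this]
      refine Finset.sum_congr rfl fun n _ => ?_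
      push_cast; ring_nf
    simp_rw [this]
    refine Tendsto.sub_const ?_ 1
    rw [tendsto_zero_iff_norm_tendsto_zero]
    have e : ∀ N : ℕ, ‖((N + 1 : ℝ) : ℂ) ^ (1 - s)‖ = (N + 1 : ℝ) ^ (-(s.re - 1)) := by
      intro N
      rw [Complex.norm_cpow_eq_rpow_re_of_pos (by positivity)]; simp
    simp_rw [e]
    exact (tendsto_rpow_neg_atTop (by linarith)).comp
      (tendsto_atTop_add_const_right _ _ tendsto_natCast_atTop_atTop)
  have h3 := h1.add h2
  have e : (s - 1) * riemannZeta s + (0 - 1) = riemannZeta₁ s - 1 := by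
    rw [riemannZeta_eq_inv_sub_mul hs1, mul_inv_cancel_left₀ (sub_ne_zero.mpr hs1)]; ring
  rwa [e] at h3

lemma differentiable_zetaTerm (n : ℕ) : Differentiable ℂ (fun s => zetaTerm s n) := by
  have h1 : ((n + 1 : ℝ) : ℂ) ≠ 0 := by exact_mod_cast (by positivity : (n + 1 : ℝ) ≠ 0)
  have h2 : ((n + 2 : ℝ) : ℂ) ≠ 0 := by exact_mod_cast (by positivity : (n + 2 : ℝ) ≠ 0)
  unfold zetaTerm
  intro s
  have a1 : DifferentiableAt ℂ (fun s : ℂ => ((n + 1 : ℝ) : ℂ) ^ (-s)) s :=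
    differentiableAt_id.neg.const_cpow (Or.inl h1)
  have a2 : DifferentiableAt ℂ (fun s : ℂ => ((n + 1 : ℝ) : ℂ) ^ (1 - s)) s :=
    (differentiableAt_id.const_sub 1).const_cpow (Or.inl h1)
  have a3 : DifferentiableAt ℂ (fun s : ℂ => ((n + 2 : ℝ) : ℂ) ^ (1 - s)) s :=
    (differentiableAt_id.const_sub 1).const_cpow (Or.inl h2)
  exact ((differentiableAt_id.sub_const 1).mul a1).add (a3.sub a2)

lemma tsum_zetaTerm_eq {θ : ℝ} (h0 : 0 < θ) (h1 : θ ≤ 1) {s : ℂ} (hs : 1 - θ / 2 < s.re) :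
    ∑' n, zetaTerm s n = riemannZeta₁ s - 1 := by
  set R : ℝ := ‖s‖ + 3
  set U : Set ℂ := {z | 1 - θ / 2 < z.re} ∩ Metric.ball 0 R with hU
  have hUo : IsOpen U := (isOpen_lt continuous_const Complex.continuous_re).inter Metric.isOpen_ball
  have hUc : Convex ℝ U := (convex_halfSpace_re_gt _).inter (convex_ball _ _)
  have hdiff : DifferentiableOn ℂ (fun s => ∑' n, zetaTerm s n) U := by
    refine Complex.differentiableOn_tsum_of_summable_norm
      (u := fun n : ℕ => (R + 1) * (2 * R ^ θ * (n + 1 : ℝ) ^ (-1 - θ / 2))) ?_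
      (fun n => (differentiable_zetaTerm n).differentiableOn) hUo ?_
    · have := (summable_nat_add_iff 1).mpr
        (Real.summable_nat_rpow (p := -1 - θ / 2) |>.mpr (by linarith))
      refine Summable.mul_left _ (Summable.mul_left _ ?_)
      simpa using this
    · rintro n w ⟨hw1, hw2⟩
      simp only [Set.mem_ofPred_eq] at hw1
      have hw3 : ‖w‖ < R := by simpa using hw2
      refine (norm_zetaTerm_le h0.le h1 (by linarith) n).trans ?_
      have : ‖w - 1‖ ≤ R + 1 := (norm_sub_le _ _).trans (by simp; linarith)
      have h3 : (n + 1 : ℝ) ^ (-w.re - θ) ≤ (n + 1 : ℝ) ^ (-1 - θ / 2) :=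
        Real.rpow_le_rpow_of_exponent_le (by simp) (by linarith)
      gcongr
  have heq := AnalyticOnNhd.eqOn_of_preconnected_of_eventuallyEq
    (hdiff.analyticOnNhd hUo)
    ((differentiable_riemannZeta₁.sub_const 1).differentiableOn.analyticOnNhd hUo)
    hUc.isPreconnected (z₀ := 2) ?_ ?_
  · refine heq ⟨hs, ?_⟩
    simp [R]
  · refine ⟨?_, ?_⟩
    · simp; linarith
    · simp [R]; linarith [norm_nonneg s]
  · have : {z : ℂ | 1 < z.re} ∈ nhds (2 : ℂ) :=
      (isOpen_lt continuous_const Complex.continuous_re).mem_nhds (by simp)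
    filter_upwards [this] with z hz
    exact (hasSum_zetaTerm_of_one_lt_re hz).tsum_eq

/-- A convexity-free bound for `ζ` slightly to the left of the line `re s = 1`. -/
lemma exists_norm_riemannZeta₀_le {θ : ℝ} (h0 : 0 < θ) (h1 : θ ≤ 1) :
    ∃ C : ℝ, 0 < C ∧ ∀ s : ℂ, 1 - θ / 2 < s.re → s ≠ 1 → ‖riemannZeta₀ s‖ ≤ C * ‖s‖ ^ θ := by
  have hsum : Summable fun n : ℕ => (n + 1 : ℝ) ^ (-1 - θ / 2) := by
    have := (summable_nat_add_iff 1).mpr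
      (Real.summable_nat_rpow (p := -1 - θ / 2) |>.mpr (by linarith))
    simpa using this
  refine ⟨2 * ∑' n : ℕ, (n + 1 : ℝ) ^ (-1 - θ / 2), ?_, ?_⟩
  · have := hsum.tsum_pos (fun n => by positivity) 0 (by simp)
    linarith
  · intro s hs hs1
    have h := tsum_zetaTerm_eq h0 h1 hs
    have hle : ‖∑' n, zetaTerm s n‖ ≤
        ∑' n : ℕ, ‖s - 1‖ * (2 * ‖s‖ ^ θ * (n + 1 : ℝ) ^ (-1 - θ / 2)) := by
      refine tsum_of_norm_bounded ((hsum.mul_left _).mul_left _).hasSum fun n => ?_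
      refine (norm_zetaTerm_le h0.le h1 (by linarith) n).trans ?_
      have h3 : (n + 1 : ℝ) ^ (-s.re - θ) ≤ (n + 1 : ℝ) ^ (-1 - θ / 2) :=
        Real.rpow_le_rpow_of_exponent_le (by simp) (by linarith)
      gcongr
    rw [h, riemannZeta₁, add_sub_cancel_left, norm_mul, tsum_mul_left, tsum_mul_left] at hle
    have := le_of_mul_le_mul_left hle (norm_pos_iff.mpr (sub_ne_zero.mpr hs1))
    linarith

lemma exists_norm_iteratedDeriv_riemannZeta_le {θ : ℝ} (h0 : 0 < θ) (h1 : θ ≤ 1) :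
    ∃ C : ℝ, 1 ≤ C ∧ ∀ k ≤ 2, ∀ s : ℂ, 1 < s.re → s.re ≤ 2 → 1 ≤ |s.im| →
      ‖iteratedDeriv k riemannZeta s‖ ≤ C * |s.im| ^ θ := by
  obtain ⟨C, hC, hb⟩ := exists_norm_riemannZeta₀_le h0 h1
  set r : ℝ := θ / 4 with hr
  have hr0 : 0 < r := by positivity
  have hr1 : r ≤ 1 / 4 := by rw [hr]; linarith
  refine ⟨2 * (2 + 4 * C) / r ^ 2, ?_, ?_⟩
  · rw [le_div_iff₀ (by positivity)]
    nlinarith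
  intro k hk s hs1 hs2 hs3
  have hw : ∀ w ∈ Metric.closedBall s r, 1 - θ / 2 < w.re ∧ 3 / 4 ≤ |w.im| ∧ ‖w‖ ≤ 4 * |s.im| := by
    intro w hw
    rw [mem_closedBall_iff_norm] at hw
    have hre := (Complex.abs_re_le_norm (w - s)).trans hw
    have him := (Complex.abs_im_le_norm (w - s)).trans hw
    rw [Complex.sub_re, abs_le] at hre
    rw [Complex.sub_im] at him
    refine ⟨by rw [hr] at hre; linarith, ?_, ?_⟩
    · have := abs_sub_abs_le_abs_sub s.im w.im
      rw [abs_sub_comm] at this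
      linarith
    · have h2 : ‖w‖ ≤ ‖s‖ + r := by
        have := norm_add_le s (w - s)
        rw [add_sub_cancel] at this; linarith
      have h3 := Complex.norm_le_abs_re_add_abs_im s
      rw [abs_of_pos (by linarith : (0:ℝ) < s.re)] at h3
      linarith
  have hne : ∀ w ∈ Metric.closedBall s r, w ≠ 1 := by
    rintro w hw' rfl
    have := (hw _ hw').2.1
    simp at this; linarith
  have hbound : ∀ w ∈ Metric.sphere s r, ‖riemannZeta w‖ ≤ (2 + 4 * C) * |s.im| ^ θ := by
    intro w hws
    have hwc := Metric.sphere_subset_closedBall hws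
    obtain ⟨g1, g2, g3⟩ := hw w hwc
    rw [riemannZeta_eq_inv_sub_add (hne w hwc)]
    refine (norm_add_le _ _).trans ?_
    have hone : 1 ≤ |s.im| ^ θ := Real.one_le_rpow hs3 h0.le
    have i1 : ‖(w - 1)⁻¹‖ ≤ 2 := by
      rw [norm_inv]
      have := Complex.abs_im_le_norm (w - 1)
      rw [Complex.sub_im, Complex.one_im, sub_zero] at this
      rw [inv_le_comm₀ (by linarith) (by norm_num)]
      linarith
    have i2 : ‖w‖ ^ θ ≤ 4 * |s.im| ^ θ := by
      calc ‖w‖ ^ θ ≤ (4 * |s.im|) ^ θ := Real.rpow_le_rpow (norm_nonneg _) g3 h0.le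
        _ = 4 ^ θ * |s.im| ^ θ := Real.mul_rpow (by norm_num) (abs_nonneg _)
        _ ≤ 4 * |s.im| ^ θ := by
          gcongr
          calc (4 : ℝ) ^ θ ≤ 4 ^ (1 : ℝ) := Real.rpow_le_rpow_of_exponent_le (by norm_num) h1
            _ = 4 := Real.rpow_one 4
    have i3 := hb w g1 (hne w hwc)
    have i4 := mul_le_mul_of_nonneg_left i2 hC.le
    linarith
  have hd : DiffContOnCl ℂ riemannZeta (Metric.ball s r) := by
    apply DifferentiableOn.diffContOnCl
    rw [closure_ball _ hr0.ne']
    exact fun w hwc => (differentiableAt_riemannZeta (hne w hwc)).differentiableWithinAt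
  refine (Complex.norm_iteratedDeriv_le_of_forall_mem_sphere_norm_le k hr0 hd hbound).trans ?_
  have hk2 : (k.factorial : ℝ) ≤ 2 := by
    have := Nat.factorial_le hk
    exact_mod_cast this
  have hrk : r ^ 2 ≤ r ^ k := pow_le_pow_of_le_one hr0.le (by linarith) hk
  rw [div_mul_eq_mul_div, mul_assoc]
  gcongr

lemma exists_norm_riemannZeta_real_le :
    ∃ C : ℝ, 1 ≤ C ∧ ∀ x : ℝ, 0 < x → x ≤ 1 → ‖riemannZeta (1 + x)‖ ≤ C / x := by
  obtain ⟨C, hC, hb⟩ := exists_norm_riemannZeta₀_le one_pos le_rfl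
  refine ⟨1 + 2 * C, by linarith, fun x hx hx1 => ?_⟩
  have hne : (1 + x : ℂ) ≠ 1 := by simpa using hx.ne'
  have h := hb (1 + x) (by simp; linarith) hne
  have hn : ‖(1 + x : ℂ)‖ ≤ 2 := by
    refine (norm_add_le _ _).trans ?_
    simp [abs_of_pos hx]; linarith
  rw [Real.rpow_one] at h
  rw [riemannZeta_eq_inv_sub_add hne]
  refine (norm_add_le _ _).trans ?_
  have h1 : ‖((1 + x : ℂ) - 1)⁻¹‖ = 1 / x := by simp [abs_of_pos hx]
  rw [h1, add_div]
  gcongr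
  rw [le_div_iff₀ hx]
  have h2 : ‖riemannZeta₀ (1 + x)‖ ≤ 2 * C := by nlinarith
  nlinarith [norm_nonneg (riemannZeta₀ (1 + x))]

lemma norm_riemannZeta_product_ge_one {x : ℝ} (hx : 0 < x) (y : ℝ) :
    1 ≤ ‖riemannZeta (1 + x)‖ ^ 3 * ‖riemannZeta (1 + x + Complex.I * y)‖ ^ 4 *
      ‖riemannZeta (1 + x + 2 * Complex.I * y)‖ := by
  have h := DirichletCharacter.norm_LSeries_product_ge_one (N := 1) (1 : DirichletCharacter ℂ 1) hx y
  rw [one_pow] at h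
  have e : ∀ s : ℂ, 1 < s.re → LSeries (fun n : ℕ => (1 : DirichletCharacter ℂ 1) n) s = riemannZeta s := by
    intro s hs
    rw [← LSeries_one_eq_riemannZeta hs]
    refine LSeries_congr (fun {n} hn => ?_) s
    rw [MulChar.one_apply (isUnit_of_subsingleton _), Pi.one_apply]
  rw [e _ (by simpa using hx), e _ (by simpa using hx), e _ (by simpa using hx)] at h
  simpa [norm_mul, norm_pow] using h

/-- A quantitative form of the nonvanishing of `ζ` on the line `re s = 1`. -/
lemma exists_norm_inv_riemannZeta_le {θ : ℝ} (h0 : 0 < θ) (h1 : θ ≤ 1) :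
    ∃ C : ℝ, 1 ≤ C ∧ ∀ s : ℂ, 1 < s.re → s.re ≤ 2 → 1 ≤ |s.im| →
      ‖(riemannZeta s)⁻¹‖ ≤ C * (|s.im| ^ θ) ^ 4 := by
  obtain ⟨C₁, hC₁, hb₁⟩ := exists_norm_iteratedDeriv_riemannZeta_le h0 h1
  obtain ⟨C₂, hC₂, hb₂⟩ := exists_norm_riemannZeta_real_le
  obtain ⟨C, hC, hCC₁, hCC₂⟩ : ∃ C : ℝ, 1 ≤ C ∧ C₁ ≤ C ∧ C₂ ≤ C :=
    ⟨max C₁ C₂, hC₁.trans (le_max_left _ _), le_max_left _ _, le_max_right _ _⟩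
  refine ⟨32 * C ^ 7, by have := one_le_pow₀ hC (n := 7); linarith, fun s hs1 hs2 hs3 => ?_⟩
  set τ := |s.im| ^ θ with hτ
  have hτ1 : 1 ≤ τ := Real.one_le_rpow hs3 h0.le
  have hτ0 : 0 < τ := by linarith
  have hC0 : 0 < C := by linarith
  set x₀ : ℝ := 1 / (32 * C ^ 8 * τ ^ 5) with hx₀
  have hx₀0 : 0 < x₀ := by positivity
  have hx₀1 : x₀ ≤ 1 := by
    rw [hx₀, div_le_one (by positivity)]
    have := one_le_mul_of_one_le_of_one_le (one_le_pow₀ hC (n := 8)) (one_le_pow₀ hτ1 (n := 5))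
    linarith
  have hlow : ∀ x : ℝ, x₀ ≤ x → x ≤ 1 →
      2 * C * x₀ * τ ≤ ‖riemannZeta (1 + x + Complex.I * s.im)‖ := by
    intro x hx hx1
    have hx0 : 0 < x := by linarith
    have h := norm_riemannZeta_product_ge_one hx0 s.im
    have e1 : ‖riemannZeta (1 + x)‖ ≤ C / x := (hb₂ x hx0 hx1).trans (by gcongr)
    have e2 : ‖riemannZeta (1 + x + 2 * Complex.I * s.im)‖ ≤ 2 * C * τ := by
      have := hb₁ 0 (by norm_num) (1 + x + 2 * Complex.I * s.im) (by simpa using hx0)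
        (by simp; linarith) (by simp [abs_mul]; linarith)
      rw [iteratedDeriv_zero] at this
      refine this.trans ?_
      have him : (1 + x + 2 * Complex.I * s.im : ℂ).im = 2 * s.im := by simp
      rw [him, abs_mul, Real.mul_rpow (by norm_num) (abs_nonneg _), abs_two]
      have h2 : (2 : ℝ) ^ θ ≤ 2 := by
        calc (2 : ℝ) ^ θ ≤ 2 ^ (1 : ℝ) := Real.rpow_le_rpow_of_exponent_le (by norm_num) h1
          _ = 2 := Real.rpow_one 2
      calc C₁ * (2 ^ θ * |s.im| ^ θ) ≤ C * (2 * τ) := by gcongr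
        _ = 2 * C * τ := by ring
    set z := ‖riemannZeta (1 + x + Complex.I * s.im)‖ with hz
    have hz0 : 0 ≤ z := norm_nonneg _
    have h4 : 1 ≤ (C / x) ^ 3 * z ^ 4 * (2 * C * τ) := h.trans (by gcongr)
    refine le_of_pow_le_pow_left₀ (n := 4) (by norm_num) hz0 ?_
    have h5 : x₀ ^ 3 ≤ 2 * C ^ 4 * τ * z ^ 4 := by
      have h6 : x ^ 3 ≤ 2 * C ^ 4 * τ * z ^ 4 := by
        have : (C / x) ^ 3 * z ^ 4 * (2 * C * τ) = 2 * C ^ 4 * τ * z ^ 4 / x ^ 3 := by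
          field_simp
        rwa [this, le_div_iff₀ (by positivity), one_mul] at h4
      exact (pow_le_pow_left₀ hx₀0.le hx 3).trans h6
    have h7 : x₀ * (32 * C ^ 8 * τ ^ 5) = 1 := by rw [hx₀]; field_simp
    have h8 : (2 * C * x₀ * τ) ^ 4 * (2 * C ^ 4 * τ) = x₀ ^ 3 := by
      calc (2 * C * x₀ * τ) ^ 4 * (2 * C ^ 4 * τ) = x₀ ^ 3 * (x₀ * (32 * C ^ 8 * τ ^ 5)) := by ring
        _ = x₀ ^ 3 := by rw [h7, mul_one]
    have h9 : (2 * C * x₀ * τ) ^ 4 * (2 * C ^ 4 * τ) ≤ z ^ 4 * (2 * C ^ 4 * τ) := by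
      rw [h8]; linarith
    exact le_of_mul_le_mul_right h9 (by positivity)
  have hs : s = 1 + ((s.re - 1 : ℝ) : ℂ) + Complex.I * s.im := by
    apply Complex.ext <;> simp
  have hfinal : C * x₀ * τ ≤ ‖riemannZeta s‖ := by
    rcases le_total x₀ (s.re - 1) with hx | hx
    · have := hlow (s.re - 1) hx (by linarith)
      rw [← hs] at this
      have : 0 ≤ C * x₀ * τ := by positivity
      linarith
    · set s' : ℂ := 1 + x₀ + Complex.I * s.im with hs'
      have h2 := hlow x₀ le_rfl hx₀1
      have hre' : s'.re = 1 + x₀ := by simp [hs']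
      have him' : s'.im = s.im := by simp [hs']
      have hmv := Convex.norm_image_sub_le_of_norm_deriv_le (𝕜 := ℂ) (f := riemannZeta)
        (s := {z : ℂ | 1 < z.re} ∩ {z | z.re ≤ 2} ∩ {z | z.im = s.im}) (C := C * τ) (x := s) (y := s')
        ?_ ?_ ?_ ?_ ?_
      · have hd : ‖s' - s‖ ≤ x₀ := by
          have : s' - s = ((x₀ - (s.re - 1) : ℝ) : ℂ) := by
            apply Complex.ext <;> simp [hre', him']; ring
          rw [this, Complex.norm_real, Real.norm_eq_abs, abs_of_nonneg (by linarith)]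
          linarith
        have h3 : ‖riemannZeta s' - riemannZeta s‖ ≤ C * τ * x₀ := hmv.trans (by gcongr)
        have h4 := norm_sub_norm_le (riemannZeta s') (riemannZeta s)
        linarith
      · rintro z ⟨⟨hz1, hz2⟩, hz3⟩
        refine differentiableAt_riemannZeta ?_
        rintro rfl; simp at hz1
      · rintro z ⟨⟨hz1, hz2⟩, hz3⟩
        simp only [Set.mem_ofPred_eq] at hz1 hz2 hz3
        have := hb₁ 1 (by norm_num) z hz1 hz2 (by rw [hz3]; exact hs3)
        rw [iteratedDeriv_one, hz3] at this
        exact this.trans (by gcongr)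
      · refine ((convex_halfSpace_re_gt _).inter (convex_halfSpace_re_le _)).inter ?_
        exact convex_hyperplane (f := fun z : ℂ => z.im) Complex.imLm.isLinear _
      · exact ⟨⟨hs1, hs2⟩, rfl⟩
      · refine ⟨⟨?_, ?_⟩, ?_⟩ <;> simp only [Set.mem_ofPred_eq] <;> linarith
  rw [norm_inv]
  have h10 : C * x₀ * τ = (32 * C ^ 7 * τ ^ 4)⁻¹ := by
    rw [hx₀]; field_simp
  rw [h10] at hfinal
  exact inv_le_of_inv_le₀ (by positivity) hfinal

lemma LSeries_moebius_eq_inv {s : ℂ} (hs : 1 < s.re) :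
    LSeries (fun n => (moebius n : ℂ)) s = (riemannZeta s)⁻¹ := by
  have h := LSeries_one_mul_Lseries_moebius hs
  rw [LSeries_one_eq_riemannZeta hs] at h
  exact eq_inv_of_mul_eq_one_right h

lemma hasDerivAt_inv_riemannZeta {s : ℂ} (hs : 1 < s.re) :
    HasDerivAt (fun z => (riemannZeta z)⁻¹) (-deriv riemannZeta s / riemannZeta s ^ 2) s := by
  have hne : s ≠ 1 := by rintro rfl; simp at hs
  exact (differentiableAt_riemannZeta hne).hasDerivAt.inv
    (riemannZeta_ne_zero_of_one_lt_re hs)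

lemma iteratedDeriv_two_inv_riemannZeta {s : ℂ} (hs : 1 < s.re) :
    iteratedDeriv 2 (fun z => (riemannZeta z)⁻¹) s =
      2 * deriv riemannZeta s ^ 2 * (riemannZeta s)⁻¹ ^ 3 -
        iteratedDeriv 2 riemannZeta s * (riemannZeta s)⁻¹ ^ 2 := by
  have hne : s ≠ 1 := by rintro rfl; simp at hs
  have hz := riemannZeta_ne_zero_of_one_lt_re hs
  have hU : {z : ℂ | 1 < z.re} ∈ nhds s :=
    (isOpen_lt continuous_const Complex.continuous_re).mem_nhds hs
  rw [iteratedDeriv_succ, iteratedDeriv_one]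
  have he : deriv (fun z => (riemannZeta z)⁻¹) =ᶠ[nhds s]
      fun z => -deriv riemannZeta z / riemannZeta z ^ 2 := by
    filter_upwards [hU] with z hz using (hasDerivAt_inv_riemannZeta hz).deriv
  rw [he.deriv_eq]
  have hd1 := (differentiableAt_riemannZeta hne).hasDerivAt
  have hd2 : HasDerivAt (deriv riemannZeta) (iteratedDeriv 2 riemannZeta s) s := by
    rw [iteratedDeriv_succ, iteratedDeriv_one]
    have : DifferentiableOn ℂ riemannZeta {z : ℂ | 1 < z.re} := fun z hz =>
      (differentiableAt_riemannZeta (by rintro rfl; simp at hz)).differentiableWithinAt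
    exact ((this.analyticAt hU).deriv.differentiableAt).hasDerivAt
  refine ((hd2.neg.div (hd1.pow 2) (pow_ne_zero 2 hz)).deriv).trans ?_
  simp only [Pi.neg_apply, Pi.pow_apply]
  field_simp
  ring

lemma LSeries_logMul_logMul_moebius {s : ℂ} (hs : 1 < s.re) :
    LSeries (LSeries.logMul^[2] fun n => (moebius n : ℂ)) s =
      iteratedDeriv 2 (fun z => (riemannZeta z)⁻¹) s := by
  have h := LSeries_iteratedDeriv (f := fun n => (moebius n : ℂ)) 2 (s := s)
    (by rw [abscissaOfAbsConv_moebius]; exact_mod_cast hs)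
  rw [neg_one_sq, one_mul] at h
  rw [← h]
  have hU : {z : ℂ | 1 < z.re} ∈ nhds s :=
    (isOpen_lt continuous_const Complex.continuous_re).mem_nhds hs
  refine Filter.EventuallyEq.iteratedDeriv_eq 2 ?_
  filter_upwards [hU] with z hz using LSeries_moebius_eq_inv hz

lemma riemannZeta₁_ne_zero {s : ℂ} (hs : 1 ≤ s.re) : riemannZeta₁ s ≠ 0 := by
  rcases eq_or_ne s 1 with rfl | h
  · simp
  · have h1 := riemannZeta_ne_zero_of_one_le_re hs
    rw [riemannZeta_eq_inv_sub_mul h] at h1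
    exact right_ne_zero_of_mul h1

lemma exists_norm_iteratedDeriv_two_inv_riemannZeta_le_of_abs_im_le :
    ∃ C : ℝ, ∀ s : ℂ, 1 < s.re → s.re ≤ 2 → |s.im| ≤ 1 →
      ‖iteratedDeriv 2 (fun z => (riemannZeta z)⁻¹) s‖ ≤ C := by
  set V : Set ℂ := {z | riemannZeta₁ z ≠ 0}
  have hV : IsOpen V := isOpen_ne_fun differentiable_riemannZeta₁.continuous continuous_const
  set q : ℂ → ℂ := fun z => (z - 1) / riemannZeta₁ z
  have hq : AnalyticOnNhd ℂ q V := by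
    refine DifferentiableOn.analyticOnNhd (fun z hz => ?_) hV
    exact ((differentiableAt_id.sub_const 1).div (differentiable_riemannZeta₁ z) hz).differentiableWithinAt
  have hc : ContinuousOn (deriv (deriv q)) V := hq.deriv.deriv.continuousOn
  have hK : IsCompact (Set.Icc (1 : ℝ) 2 ×ℂ Set.Icc (-1 : ℝ) 1) := isCompact_Icc.reProdIm isCompact_Icc
  have hKV : (Set.Icc (1 : ℝ) 2 ×ℂ Set.Icc (-1 : ℝ) 1) ⊆ V := fun z hz =>
    riemannZeta₁_ne_zero hz.1.1
  obtain ⟨C, hC⟩ := hK.exists_bound_of_continuousOn (hc.mono hKV)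
  refine ⟨C, fun s h1 h2 h3 => ?_⟩
  have hU : {z : ℂ | 1 < z.re} ∈ nhds s :=
    (isOpen_lt continuous_const Complex.continuous_re).mem_nhds h1
  have he : (fun z => (riemannZeta z)⁻¹) =ᶠ[nhds s] q := by
    filter_upwards [hU] with z hz
    have : z ≠ 1 := by rintro rfl; simp at hz
    simp only [q]
    rw [riemannZeta_eq_inv_sub_mul this, mul_inv, inv_inv, div_eq_mul_inv]
  rw [he.iteratedDeriv_eq 2, iteratedDeriv_succ, iteratedDeriv_one]
  exact hC s ⟨⟨h1.le, h2⟩, abs_le.mp h3⟩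

/-- The second derivative of `1 / ζ`, divided by `s`, is dominated on `1 < re s ≤ 2` by a
square-integrable function of `im s`. -/
lemma exists_norm_LSeries_logMul_logMul_moebius_div_le :
    ∃ C : ℝ, 0 ≤ C ∧ ∀ s : ℂ, 1 < s.re → s.re ≤ 2 →
      ‖LSeries (LSeries.logMul^[2] fun n => (moebius n : ℂ)) s / s‖ ≤
        C * (1 + |s.im|) ^ (-(13 / 20) : ℝ) := by
  have h0 : (0 : ℝ) < 1 / 40 := by norm_num
  have h1 : (1 / 40 : ℝ) ≤ 1 := by norm_num
  obtain ⟨C₀, hb₀⟩ := exists_norm_iteratedDeriv_two_inv_riemannZeta_le_of_abs_im_le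
  obtain ⟨C₁, hC₁, hb₁⟩ := exists_norm_iteratedDeriv_riemannZeta_le h0 h1
  obtain ⟨C₂, hC₂, hb₂⟩ := exists_norm_inv_riemannZeta_le h0 h1
  set D : ℝ := 2 * C₁ ^ 2 * C₂ ^ 3 + C₁ * C₂ ^ 2 with hD
  have hD0 : 0 ≤ D := by positivity
  have hmax0 : 0 ≤ max (2 * |C₀|) (2 * D) := le_max_of_le_right (by linarith)
  refine ⟨max (2 * |C₀|) (2 * D), hmax0, fun s hs1 hs2 => ?_⟩
  rw [LSeries_logMul_logMul_moebius hs1, norm_div]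
  have hsn : s.re ≤ ‖s‖ := (le_abs_self _).trans (Complex.abs_re_le_norm s)
  have two_half : ∀ u : ℝ, 0 < u → u ^ (-(13 / 20) : ℝ) ≤ 2 * (2 * u) ^ (-(13 / 20) : ℝ) := by
    intro u hu
    rw [Real.mul_rpow (by norm_num) hu.le, ← mul_assoc]
    have : (1 : ℝ) ≤ 2 * 2 ^ (-(13 / 20) : ℝ) := by
      calc (1 : ℝ) = 2 * 2 ^ (-1 : ℝ) := by rw [Real.rpow_neg_one]; norm_num
        _ ≤ 2 * 2 ^ (-(13 / 20) : ℝ) := by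
          gcongr 2 * ?_
          exact Real.rpow_le_rpow_of_exponent_le (by norm_num) (by norm_num)
    have h3 : 0 ≤ u ^ (-(13 / 20) : ℝ) := by positivity
    nlinarith
  rcases le_total |s.im| 1 with h | h
  · have hC₀ : ‖iteratedDeriv 2 (fun z => (riemannZeta z)⁻¹) s‖ ≤ |C₀| :=
      (hb₀ s hs1 hs2 h).trans (le_abs_self _)
    have e1 : (1 : ℝ) ≤ 2 * (1 + |s.im|) ^ (-(13 / 20) : ℝ) := by
      have := two_half 1 one_pos
      rw [Real.one_rpow, mul_one] at this
      refine this.trans ?_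
      gcongr 2 * ?_
      exact Real.rpow_le_rpow_of_nonpos (by positivity) (by linarith) (by norm_num)
    calc ‖iteratedDeriv 2 (fun z => (riemannZeta z)⁻¹) s‖ / ‖s‖ ≤ |C₀| / 1 := by
          gcongr; linarith
      _ ≤ |C₀| * (2 * (1 + |s.im|) ^ (-(13 / 20) : ℝ)) := by
          rw [div_one]; exact le_mul_of_one_le_right (abs_nonneg _) e1
      _ = (2 * |C₀|) * (1 + |s.im|) ^ (-(13 / 20) : ℝ) := by ring
      _ ≤ _ := by gcongr; exact le_max_left _ _
  · set τ := |s.im| ^ (1 / 40 : ℝ) with hτ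
    have hτ1 : 1 ≤ τ := Real.one_le_rpow h h0.le
    have him0 : 0 < |s.im| := by linarith
    have hτ14 : τ ^ 14 / |s.im| = |s.im| ^ (-(13 / 20) : ℝ) := by
      rw [hτ, ← Real.rpow_natCast, ← Real.rpow_mul him0.le, div_eq_mul_inv, ← Real.rpow_neg_one,
        ← Real.rpow_add him0]
      norm_num
    have a1 : ‖deriv riemannZeta s‖ ≤ C₁ * τ := by
      have := hb₁ 1 (by norm_num) s hs1 hs2 h
      rwa [iteratedDeriv_one] at this
    have a2 : ‖iteratedDeriv 2 riemannZeta s‖ ≤ C₁ * τ := hb₁ 2 le_rfl s hs1 hs2 h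
    have a3 : ‖(riemannZeta s)⁻¹‖ ≤ C₂ * τ ^ 4 := hb₂ s hs1 hs2 h
    have hF : ‖iteratedDeriv 2 (fun z => (riemannZeta z)⁻¹) s‖ ≤ D * τ ^ 14 := by
      rw [iteratedDeriv_two_inv_riemannZeta hs1]
      refine (norm_sub_le _ _).trans ?_
      rw [norm_mul, norm_mul, norm_mul, norm_pow, norm_pow, norm_pow, Complex.norm_two]
      calc 2 * ‖deriv riemannZeta s‖ ^ 2 * ‖(riemannZeta s)⁻¹‖ ^ 3 +
          ‖iteratedDeriv 2 riemannZeta s‖ * ‖(riemannZeta s)⁻¹‖ ^ 2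
          ≤ 2 * (C₁ * τ) ^ 2 * (C₂ * τ ^ 4) ^ 3 + (C₁ * τ) * (C₂ * τ ^ 4) ^ 2 := by gcongr
        _ = 2 * C₁ ^ 2 * C₂ ^ 3 * τ ^ 14 + C₁ * C₂ ^ 2 * τ ^ 9 := by ring
        _ ≤ 2 * C₁ ^ 2 * C₂ ^ 3 * τ ^ 14 + C₁ * C₂ ^ 2 * τ ^ 14 := by
          gcongr 2 * C₁ ^ 2 * C₂ ^ 3 * τ ^ 14 + C₁ * C₂ ^ 2 * ?_
          exact pow_le_pow_right₀ hτ1 (by norm_num)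
        _ = D * τ ^ 14 := by rw [hD]; ring
    calc ‖iteratedDeriv 2 (fun z => (riemannZeta z)⁻¹) s‖ / ‖s‖ ≤ D * τ ^ 14 / |s.im| := by
          gcongr; exact Complex.abs_im_le_norm s
      _ = D * |s.im| ^ (-(13 / 20) : ℝ) := by rw [mul_div_assoc, hτ14]
      _ ≤ D * (2 * (2 * |s.im|) ^ (-(13 / 20) : ℝ)) := by gcongr; exact two_half _ him0
      _ ≤ D * (2 * (1 + |s.im|) ^ (-(13 / 20) : ℝ)) := by
          gcongr D * (2 * ?_)
          exact Real.rpow_le_rpow_of_nonpos (by positivity) (by linarith) (by norm_num)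
      _ = 2 * D * (1 + |s.im|) ^ (-(13 / 20) : ℝ) := by ring
      _ ≤ _ := by gcongr; exact le_max_right _ _

open MeasureTheory FourierTransform in
lemma integral_norm_sq_fourier_eq {h : ℝ → ℂ} (h1 : Integrable h) (h2 : MemLp h 2)
    (h3 : MemLp (𝓕 h) 2) : ∫ x, ‖𝓕 h x‖ ^ 2 = ∫ x, ‖h x‖ ^ 2 := by
  have key : 𝓕 (h2.toLp h) = h3.toLp (𝓕 h) := by
    have hinj : Function.Injective (Lp.toTemperedDistributionCLM ℂ (volume : Measure ℝ) 2) :=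
      LinearMap.ker_eq_bot.mp Lp.ker_toTemperedDistributionCLM_eq_bot
    apply hinj
    rw [Lp.toTemperedDistributionCLM_apply, Lp.toTemperedDistributionCLM_apply]
    rw [← Lp.fourier_toTemperedDistribution_eq]
    ext g
    rw [TemperedDistribution.fourier_apply, Lp.toTemperedDistribution_apply,
      Lp.toTemperedDistribution_apply]
    have e1 : ∫ x, (𝓕 g) x • (h2.toLp h) x = ∫ x, (𝓕 (g : ℝ → ℂ)) x • h x := by
      refine integral_congr_ae ?_
      filter_upwards [h2.coeFn_toLp] with x hx
      rw [hx, SchwartzMap.fourier_coe]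
    have e2 : ∫ x, g x • (h3.toLp (𝓕 h)) x = ∫ x, g x • 𝓕 h x := by
      refine integral_congr_ae ?_
      filter_upwards [h3.coeFn_toLp] with x hx
      rw [hx]
    rw [e1, e2]
    have := VectorFourier.integral_fourierIntegral_smul_eq_flip (μ := volume) (ν := volume)
      (L := innerₗ ℝ) (f := (g : ℝ → ℂ)) (g := h) Real.continuous_fourierChar
      continuous_inner g.integrable h1
    simpa [Real.fourier_eq, VectorFourier.fourierIntegral, mul_comm] using this
  have hn := Lp.norm_fourier_eq (h2.toLp h)
  rw [key, Lp.norm_toLp, Lp.norm_toLp] at hn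
  have f (u : ℝ → ℂ) (hu : MemLp u 2) : ∫ x, ‖u x‖ ^ 2 = (eLpNorm u 2).toReal ^ 2 := by
    have h0 : 0 ≤ ∫ x, ‖u x‖ ^ 2 := integral_nonneg fun _ => by positivity
    rw [hu.eLpNorm_eq_integral_rpow_norm (by norm_num) (by norm_num),
      ENNReal.toReal_ofReal (by positivity)]
    simp only [ENNReal.toReal_ofNat, Real.rpow_ofNat]
    rw [← Real.rpow_natCast, ← Real.rpow_mul h0]
    norm_num
  rw [f _ h2, f _ h3, hn]

/-- The summatory function of `a`, in the logarithmic variable and with exponential damping. -/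
noncomputable def dampedSum (a : ℕ → ℂ) (σ u : ℝ) : ℂ :=
  (Real.exp (σ * u) : ℂ) * ∑ k ∈ Finset.Icc 1 ⌊Real.exp (-u)⌋₊, a k

lemma measurable_dampedSum (a : ℕ → ℂ) (σ : ℝ) : Measurable (dampedSum a σ) := by
  have h1 : Measurable fun u : ℝ => ∑ k ∈ Finset.Icc 1 ⌊Real.exp (-u)⌋₊, a k :=
    (measurable_from_nat (f := fun n : ℕ => ∑ k ∈ Finset.Icc 1 n, a k)).comp
      (Nat.measurable_floor.comp (by fun_prop))
  have h2 : Measurable fun u : ℝ => (Real.exp (σ * u) : ℂ) := by fun_prop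
  exact h2.mul h1

lemma norm_dampedSum_le {a : ℕ → ℂ} {r K : ℝ} (hr : 0 ≤ r)
    (ha : ∀ n : ℕ, ∑ k ∈ Finset.Icc 1 n, ‖a k‖ ≤ K * (n : ℝ) ^ r) (hK : 0 ≤ K) (σ u : ℝ) :
    ‖dampedSum a σ u‖ ≤ (Set.Iic 0).indicator (fun u => K * Real.exp ((σ - r) * u)) u := by
  by_cases hu : u ≤ 0
  · rw [Set.indicator_of_mem (by exact hu), dampedSum, norm_mul, Complex.norm_real,
      Real.norm_of_nonneg (Real.exp_pos _).le]
    calc Real.exp (σ * u) * ‖∑ k ∈ Finset.Icc 1 ⌊Real.exp (-u)⌋₊, a k‖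
        ≤ Real.exp (σ * u) * (K * (Real.exp (-u)) ^ r) := by
          gcongr
          refine (norm_sum_le _ _).trans ((ha _).trans ?_)
          gcongr
          exact Nat.floor_le (Real.exp_pos _).le
      _ = K * Real.exp ((σ - r) * u) := by
          rw [← Real.exp_mul, mul_left_comm, ← Real.exp_add]; ring_nf
  · rw [Set.indicator_of_notMem (by simpa using hu), dampedSum, Nat.floor_eq_zero.mpr]
    · simp
    · rw [Real.exp_lt_one_iff]; linarith

lemma integrable_dampedSum {a : ℕ → ℂ} {r K σ : ℝ} (hr : 0 ≤ r) (hσ : r < σ)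
    (ha : ∀ n : ℕ, ∑ k ∈ Finset.Icc 1 n, ‖a k‖ ≤ K * (n : ℝ) ^ r) (hK : 0 ≤ K) :
    MeasureTheory.Integrable (dampedSum a σ) := by
  refine MeasureTheory.Integrable.mono'
    (g := (Set.Iic 0).indicator (fun u => K * Real.exp ((σ - r) * u))) ?_
    (measurable_dampedSum a σ).aestronglyMeasurable
    (Eventually.of_forall fun u => norm_dampedSum_le hr ha hK σ u)
  rw [MeasureTheory.integrable_indicator_iff measurableSet_Iic]
  exact (integrableOn_exp_mul_Iic (by linarith) 0).const_mul K

lemma memLp_dampedSum {a : ℕ → ℂ} {r K σ : ℝ} (hr : 0 ≤ r) (hσ : r < σ)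
    (ha : ∀ n : ℕ, ∑ k ∈ Finset.Icc 1 n, ‖a k‖ ≤ K * (n : ℝ) ^ r) (hK : 0 ≤ K) :
    MeasureTheory.MemLp (dampedSum a σ) 2 := by
  rw [MeasureTheory.memLp_two_iff_integrable_sq_norm
    (measurable_dampedSum a σ).aestronglyMeasurable]
  refine MeasureTheory.Integrable.mono'
    (g := (Set.Iic 0).indicator (fun u => K ^ 2 * Real.exp ((2 * (σ - r)) * u))) ?_
    ((measurable_dampedSum a σ).norm.pow_const 2).aestronglyMeasurable
    (Eventually.of_forall fun u => ?_)
  · rw [MeasureTheory.integrable_indicator_iff measurableSet_Iic]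
    exact (integrableOn_exp_mul_Iic (by linarith) 0).const_mul _
  · rw [norm_pow, norm_norm]
    have := norm_dampedSum_le hr ha hK σ u
    calc ‖dampedSum a σ u‖ ^ 2
        ≤ ((Set.Iic 0).indicator (fun u => K * Real.exp ((σ - r) * u)) u) ^ 2 := by gcongr
      _ = _ := by
        by_cases hu : u ∈ Set.Iic 0
        · rw [Set.indicator_of_mem hu, Set.indicator_of_mem hu, mul_pow, ← Real.exp_nat_mul]
          push_cast; ring_nf
        · rw [Set.indicator_of_notMem hu, Set.indicator_of_notMem hu]; simp

open FourierTransform in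
lemma fourier_dampedSum {a : ℕ → ℂ} {r K σ : ℝ} (hr : 0 ≤ r) (hσ : r < σ)
    (ha : ∀ n : ℕ, ∑ k ∈ Finset.Icc 1 n, ‖a k‖ ≤ K * (n : ℝ) ^ r) (ξ : ℝ) :
    𝓕 (dampedSum a σ) ξ =
      LSeries a (⟨σ, -(2 * Real.pi * ξ)⟩ : ℂ) / (⟨σ, -(2 * Real.pi * ξ)⟩ : ℂ) := by
  set s : ℂ := ⟨σ, -(2 * Real.pi * ξ)⟩ with hs
  have hO : (fun n ↦ ∑ k ∈ Finset.Icc 1 n, ‖a k‖) =O[atTop] fun n ↦ (n : ℝ) ^ r := by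
    refine Asymptotics.IsBigO.of_bound K (Eventually.of_forall fun n => ?_)
    rw [Real.norm_of_nonneg (Finset.sum_nonneg fun _ _ => norm_nonneg _),
      Real.norm_of_nonneg (by positivity)]
    exact ha n
  have hs0 : s ≠ 0 := by
    intro h
    have : s.re = 0 := by rw [h]; rfl
    simp only [hs] at this
    linarith
  rw [LSeries_eq_mul_integral' a hr (s := s) hσ hO, mul_div_cancel_left₀ _ hs0]
  have hm := mellin_eq_fourier (fun t : ℝ => ∑ k ∈ Finset.Icc 1 ⌊t⌋₊, a k) (s := -s)
  have hπ := Real.pi_ne_zero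
  have e1 : (-s).im / (2 * Real.pi) = ξ := by
    simp only [hs, Complex.neg_im]; field_simp
  have e2 : (fun u : ℝ => Real.exp (-(-s).re * u) • ∑ k ∈ Finset.Icc 1 ⌊Real.exp (-u)⌋₊, a k) =
      dampedSum a σ := by
    ext u
    simp only [hs, Complex.neg_re, neg_neg, dampedSum, Complex.real_smul]
  rw [e1, e2] at hm
  rw [← hm, mellin, ← MeasureTheory.integral_Ici_eq_integral_Ioi (x := (1 : ℝ)),
    MeasureTheory.setIntegral_eq_of_subset_of_forall_sdiff_eq_zero measurableSet_Ioi
      (s := Set.Ici (1 : ℝ)) (fun t ht => (show (0 : ℝ) < t from lt_of_lt_of_le one_pos ht))]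
  · refine MeasureTheory.integral_congr_ae (Eventually.of_forall fun t => ?_)
    simp only [smul_eq_mul]
    rw [mul_comm]; congr 2; ring
  · rintro t ⟨ht0, ht1⟩
    rw [Nat.floor_eq_zero.mpr (by simpa using ht1)]
    simp

open FourierTransform MeasureTheory in
lemma integral_norm_sq_dampedSum_le {a : ℕ → ℂ} {r K σ C : ℝ} (hr : 0 ≤ r) (hσ : r < σ)
    (ha : ∀ n : ℕ, ∑ k ∈ Finset.Icc 1 n, ‖a k‖ ≤ K * (n : ℝ) ^ r) (hK : 0 ≤ K) (hC : 0 ≤ C)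
    (hb : ∀ y : ℝ, ‖LSeries a (⟨σ, y⟩ : ℂ) / (⟨σ, y⟩ : ℂ)‖ ≤ C * (1 + |y|) ^ (-(13 / 20) : ℝ)) :
    ∫ u, ‖dampedSum a σ u‖ ^ 2 ≤ C ^ 2 * ∫ x : ℝ, (1 + ‖x‖) ^ (-(13 / 10) : ℝ) := by
  have hInt := integrable_dampedSum hr hσ ha hK
  have hle (ξ : ℝ) : ‖𝓕 (dampedSum a σ) ξ‖ ^ 2 ≤ C ^ 2 * (1 + ‖ξ‖) ^ (-(13 / 10) : ℝ) := by
    have h1 : ‖𝓕 (dampedSum a σ) ξ‖ ≤ C * (1 + |ξ|) ^ (-(13 / 20) : ℝ) := by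
      rw [fourier_dampedSum hr hσ ha]
      refine (hb _).trans ?_
      gcongr C * ?_
      refine Real.rpow_le_rpow_of_nonpos (by positivity) ?_ (by norm_num)
      rw [abs_neg, abs_mul, abs_of_pos Real.two_pi_pos]
      have := Real.pi_gt_three
      nlinarith [abs_nonneg ξ]
    calc ‖𝓕 (dampedSum a σ) ξ‖ ^ 2 ≤ (C * (1 + |ξ|) ^ (-(13 / 20) : ℝ)) ^ 2 := by gcongr
      _ = _ := by
        rw [mul_pow, ← Real.rpow_mul_natCast (by positivity), Real.norm_eq_abs]
        norm_num
  have hg : Integrable fun x : ℝ => C ^ 2 * (1 + ‖x‖) ^ (-(13 / 10) : ℝ) :=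
    (integrable_one_add_norm (by norm_num)).const_mul _
  have hcont : Continuous (𝓕 (dampedSum a σ)) :=
    VectorFourier.fourierIntegral_continuous Real.continuous_fourierChar
      (by exact continuous_inner) hInt
  have hL : MemLp (𝓕 (dampedSum a σ)) 2 := by
    rw [memLp_two_iff_integrable_sq_norm hcont.aestronglyMeasurable]
    refine hg.mono' (hcont.norm.pow 2).aestronglyMeasurable (Eventually.of_forall fun ξ => ?_)
    rw [norm_pow, norm_norm]
    exact hle ξ
  rw [← integral_norm_sq_fourier_eq hInt (memLp_dampedSum hr hσ ha hK) hL, ← integral_const_mul]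
  refine integral_mono ?_ hg hle
  exact (memLp_two_iff_integrable_sq_norm hcont.aestronglyMeasurable).mp hL

open MeasureTheory in
lemma sum_norm_sq_le_integral {a : ℕ → ℂ} {σ : ℝ} (hσ : 0 ≤ σ)
    (hL : MemLp (dampedSum a σ) 2) (N : ℕ) :
    ∑ n ∈ Finset.range N, ‖∑ k ∈ Finset.Icc 1 (n + 1), a k‖ ^ 2 * ((n : ℝ) + 2) ^ (-(2 * σ + 1)) ≤
      ∫ u, ‖dampedSum a σ u‖ ^ 2 := by
  set f : ℝ → ℝ := fun u => ‖dampedSum a σ (-u)‖ ^ 2 with hf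
  have hInt : Integrable f :=
    ((memLp_two_iff_integrable_sq_norm
      (measurable_dampedSum a σ).aestronglyMeasurable).mp hL).comp_neg
  have e0 : ∫ u, ‖dampedSum a σ u‖ ^ 2 = ∫ u, f u :=
    (integral_neg_eq_self (fun u => ‖dampedSum a σ u‖ ^ 2) volume).symm
  have hf0 : ∀ u, 0 ≤ f u := fun u => by positivity
  rw [e0]
  have hlog (n : ℕ) : Real.log ((n : ℝ) + 1) ≤ Real.log (((n + 1 : ℕ) : ℝ) + 1) := by
    apply Real.log_le_log (by positivity)
    push_cast; linarith
  calc _ ≤ ∑ n ∈ Finset.range N,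
        ∫ u in (Real.log ((n : ℝ) + 1))..(Real.log (((n + 1 : ℕ) : ℝ) + 1)), f u := by
        gcongr with n hn
        set c : ℝ := ‖∑ k ∈ Finset.Icc 1 (n + 1), a k‖ ^ 2 with hc
        have hc0 : 0 ≤ c := by positivity
        have hn2 : (0 : ℝ) < (n : ℝ) + 2 := by positivity
        calc c * ((n : ℝ) + 2) ^ (-(2 * σ + 1))
            ≤ (Real.log (((n + 1 : ℕ) : ℝ) + 1) - Real.log ((n : ℝ) + 1)) *
              (c * ((n : ℝ) + 2) ^ (-(2 * σ))) := by
              have h1 : ((n : ℝ) + 2)⁻¹ ≤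
                  Real.log (((n + 1 : ℕ) : ℝ) + 1) - Real.log ((n : ℝ) + 1) := by
                rw [← Real.log_div (by positivity) (by positivity)]
                refine le_trans (le_of_eq ?_) (Real.one_sub_inv_le_log_of_pos (by positivity))
                push_cast
                field_simp
                ring
              rw [neg_add, Real.rpow_add hn2, Real.rpow_neg_one]
              have h2 : 0 ≤ c * ((n : ℝ) + 2) ^ (-(2 * σ)) := by positivity
              calc _ = ((n : ℝ) + 2)⁻¹ * (c * ((n : ℝ) + 2) ^ (-(2 * σ))) := by ring
                _ ≤ _ := by gcongr
          _ = ∫ u in (Real.log ((n : ℝ) + 1))..(Real.log (((n + 1 : ℕ) : ℝ) + 1)),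
              c * ((n : ℝ) + 2) ^ (-(2 * σ)) := by
              rw [intervalIntegral.integral_const, smul_eq_mul]
          _ ≤ _ := by
              refine intervalIntegral.integral_mono_on_of_le_Ioo (hlog n) (by simp)
                hInt.intervalIntegrable fun u hu => ?_
              have hu1 : (n : ℝ) + 1 ≤ Real.exp u := by
                rw [← Real.log_le_iff_le_exp (by positivity)]; exact hu.1.le
              have hu2 : Real.exp u < (n : ℝ) + 2 := by
                have := (Real.lt_log_iff_exp_lt (by positivity)).mp hu.2
                push_cast at this
                linarith
              have hfl : ⌊Real.exp u⌋₊ = n + 1 := by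
                rw [Nat.floor_eq_iff (Real.exp_pos _).le]
                push_cast
                exact ⟨hu1, by linarith⟩
              simp only [hf, dampedSum, neg_neg]
              rw [hfl, norm_mul, mul_pow, ← hc, mul_comm, Complex.norm_real,
                Real.norm_of_nonneg (Real.exp_pos _).le, ← Real.exp_nat_mul]
              gcongr
              have : Real.exp ((2 : ℕ) * (σ * -u)) = Real.exp u ^ (-(2 * σ)) := by
                rw [← Real.exp_mul]; push_cast; ring_nf
              rw [this]
              exact Real.rpow_le_rpow_of_nonpos (Real.exp_pos _) hu2.le (by linarith)
    _ = ∫ u in (Real.log (((0 : ℕ) : ℝ) + 1))..(Real.log ((N : ℝ) + 1)), f u :=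
        intervalIntegral.sum_integral_adjacent_intervals
          (a := fun n : ℕ => Real.log ((n : ℝ) + 1)) fun _ _ => hInt.intervalIntegrable
    _ ≤ ∫ u, f u := by
        rw [intervalIntegral.integral_of_le]
        · exact setIntegral_le_integral hInt (Eventually.of_forall hf0)
        · simp only [Nat.cast_zero, zero_add, Real.log_one]
          exact Real.log_nonneg (by linarith [Nat.cast_nonneg (α := ℝ) N])

/-- A mean-square bound for the summatory function of `a`, from a square-integrable bound for
its L-series on the lines `re s = σ`, uniform as `σ → 1`. -/
lemma exists_sum_norm_sq_div_le {a : ℕ → ℂ} {C : ℝ} (hC : 0 ≤ C)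
    (ha : ∀ r : ℝ, 1 < r → ∃ K : ℝ, 0 ≤ K ∧
      ∀ n : ℕ, ∑ k ∈ Finset.Icc 1 n, ‖a k‖ ≤ K * (n : ℝ) ^ r)
    (hb : ∀ s : ℂ, 1 < s.re → s.re ≤ 2 → ‖LSeries a s / s‖ ≤ C * (1 + |s.im|) ^ (-(13 / 20) : ℝ)) :
    ∃ B : ℝ, ∀ N : ℕ, ∑ n ∈ Finset.range N,
      ‖∑ k ∈ Finset.Icc 1 (n + 1), a k‖ ^ 2 / ((n : ℝ) + 2) ^ 3 ≤ B := by
  refine ⟨C ^ 2 * ∫ x : ℝ, (1 + ‖x‖) ^ (-(13 / 10) : ℝ), fun N => ?_⟩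
  have hlim : Tendsto (fun σ : ℝ => ∑ n ∈ Finset.range N,
      ‖∑ k ∈ Finset.Icc 1 (n + 1), a k‖ ^ 2 * ((n : ℝ) + 2) ^ (-(2 * σ + 1)))
      (nhdsWithin 1 (Set.Ioi 1)) (nhds (∑ n ∈ Finset.range N,
      ‖∑ k ∈ Finset.Icc 1 (n + 1), a k‖ ^ 2 * ((n : ℝ) + 2) ^ (-(2 * (1 : ℝ) + 1)))) := by
    refine tendsto_nhdsWithin_of_tendsto_nhds (Continuous.tendsto ?_ 1)
    refine continuous_finsetSum _ fun n _ => continuous_const.mul ?_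
    exact continuous_const.rpow (by fun_prop) fun _ => Or.inl (by positivity)
  have e : ∑ n ∈ Finset.range N, ‖∑ k ∈ Finset.Icc 1 (n + 1), a k‖ ^ 2 / ((n : ℝ) + 2) ^ 3 =
      ∑ n ∈ Finset.range N,
      ‖∑ k ∈ Finset.Icc 1 (n + 1), a k‖ ^ 2 * ((n : ℝ) + 2) ^ (-(2 * (1 : ℝ) + 1)) := by
    refine Finset.sum_congr rfl fun n _ => ?_
    rw [Real.rpow_neg (by positivity), div_eq_mul_inv, ← Real.rpow_natCast]
    norm_num
  rw [e]
  refine le_of_tendsto hlim ?_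
  filter_upwards [Ioc_mem_nhdsGT (show (1 : ℝ) < 2 by norm_num)] with σ hσ
  obtain ⟨K, hK, hKa⟩ := ha ((1 + σ) / 2) (by linarith [hσ.1])
  have h1 : 0 ≤ (1 + σ) / 2 := by linarith [hσ.1]
  have h2 : (1 + σ) / 2 < σ := by linarith [hσ.1]
  exact (sum_norm_sq_le_integral (by linarith [hσ.1]) (memLp_dampedSum h1 h2 hKa hK) N).trans
    (integral_norm_sq_dampedSum_le h1 h2 hKa hK hC fun y => hb ⟨σ, y⟩ hσ.1 hσ.2)

/-- The summatory function of `μ(n) log² n`. -/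
noncomputable def moebiusLogSqSum (n : ℕ) : ℝ :=
  ∑ k ∈ Finset.Icc 1 n, (moebius k : ℝ) * Real.log k ^ 2

lemma exists_sum_moebiusLogSqSum_sq_le :
    ∃ B : ℝ, ∀ N : ℕ, ∑ n ∈ Finset.range N,
      moebiusLogSqSum (n + 1) ^ 2 / ((n : ℝ) + 2) ^ 3 ≤ B := by
  obtain ⟨C, hC, hb⟩ := exists_norm_LSeries_logMul_logMul_moebius_div_le
  have hval (k : ℕ) : (LSeries.logMul^[2] fun n => (moebius n : ℂ)) k =
      (((moebius k : ℝ) * Real.log k ^ 2 : ℝ) : ℂ) := by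
    simp only [Function.iterate_succ, Function.iterate_zero, Function.comp, id, LSeries.logMul]
    rw [← Complex.natCast_log]
    push_cast
    ring
  have hgrowth : ∀ r : ℝ, 1 < r → ∃ K : ℝ, 0 ≤ K ∧ ∀ n : ℕ,
      ∑ k ∈ Finset.Icc 1 n, ‖(LSeries.logMul^[2] fun n => (moebius n : ℂ)) k‖ ≤
        K * (n : ℝ) ^ r := by
    intro r hr
    set ε := (r - 1) / 2 with hε
    have hε0 : 0 < ε := by linarith
    refine ⟨(ε⁻¹) ^ 2, by positivity, fun n => ?_⟩
    rcases Nat.eq_zero_or_pos n with rfl | hn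
    · simp; positivity
    have hn' : (0 : ℝ) < n := by exact_mod_cast hn
    calc ∑ k ∈ Finset.Icc 1 n, ‖(LSeries.logMul^[2] fun n => (moebius n : ℂ)) k‖
        ≤ ∑ k ∈ Finset.Icc 1 n, Real.log n ^ 2 := by
          gcongr with k hk
          rw [Finset.mem_Icc] at hk
          have hk0 : (0 : ℝ) < k := by exact_mod_cast hk.1
          have hkn : (k : ℝ) ≤ n := by exact_mod_cast hk.2
          rw [hval, Complex.norm_real, norm_mul, norm_pow]
          have h1 : ‖(moebius k : ℝ)‖ ≤ 1 := by
            rw [Real.norm_eq_abs]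
            exact_mod_cast abs_moebius_le_one
          have h2 : ‖Real.log k‖ ≤ Real.log n := by
            rw [Real.norm_of_nonneg (Real.log_natCast_nonneg k)]
            exact Real.log_le_log hk0 hkn
          calc _ ≤ 1 * ‖Real.log k‖ ^ 2 := by gcongr
            _ ≤ _ := by rw [one_mul]; gcongr
      _ = n * Real.log n ^ 2 := by simp
      _ ≤ n * ((n : ℝ) ^ ε / ε) ^ 2 := by
          gcongr
          · exact Real.log_le_rpow_div hn'.le hε0
      _ = (ε⁻¹) ^ 2 * ((n : ℝ) ^ (1 : ℝ) * (n : ℝ) ^ (ε * 2)) := by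
          rw [Real.rpow_one, Real.rpow_mul hn'.le]
          norm_cast
          rw [div_pow, inv_pow]; field_simp
      _ = _ := by
          rw [← Real.rpow_add hn']; congr 2; rw [hε]; ring
  obtain ⟨B, hB⟩ := exists_sum_norm_sq_div_le hC hgrowth hb
  refine ⟨B, fun N => ?_⟩
  have := hB N
  simp only [hval] at this
  simp only [← Complex.ofReal_sum, Complex.norm_real, Real.norm_eq_abs, sq_abs] at this
  exact this

lemma log_add_two_pos (n : ℕ) : 0 < Real.log ((n : ℝ) + 2) :=
  Real.log_pos (by linarith [Nat.cast_nonneg (α := ℝ) n])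

lemma inv_le_log_add_one_sub_log {x : ℝ} (hx : 0 < x) :
    (x + 1)⁻¹ ≤ Real.log (x + 1) - Real.log x := by
  rw [← Real.log_div (by positivity) (by positivity)]
  refine le_trans (le_of_eq ?_) (Real.one_sub_inv_le_log_of_pos (by positivity))
  field_simp
  ring

lemma log_add_one_sub_log_le_inv {x : ℝ} (hx : 0 < x) :
    Real.log (x + 1) - Real.log x ≤ x⁻¹ := by
  rw [← Real.log_div (by positivity) (by positivity)]
  refine (Real.log_le_sub_one_of_pos (by positivity)).trans (le_of_eq ?_)
  field_simp
  ring

lemma summable_inv_mul_log_sq :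
    Summable fun n : ℕ => (((n : ℝ) + 2) * Real.log ((n : ℝ) + 2) ^ 2)⁻¹ := by
  rw [← summable_nat_add_iff 1]
  refine summable_of_sum_range_le (c := (Real.log 2)⁻¹) (fun n => by positivity) fun N => ?_
  have hl (n : ℕ) := log_add_two_pos n
  have key (n : ℕ) : ((((n + 1 : ℕ) : ℝ) + 2) * Real.log (((n + 1 : ℕ) : ℝ) + 2) ^ 2)⁻¹ ≤
      (Real.log ((n : ℝ) + 2))⁻¹ - (Real.log (((n + 1 : ℕ) : ℝ) + 2))⁻¹ := by
    have h1 := inv_le_log_add_one_sub_log (x := (n : ℝ) + 2) (by positivity)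
    have e : (n : ℝ) + 2 + 1 = ((n + 1 : ℕ) : ℝ) + 2 := by push_cast; ring
    rw [e] at h1
    have ha := hl n
    have hb := hl (n + 1)
    have hx : 0 < ((n + 1 : ℕ) : ℝ) + 2 := by positivity
    have hab : Real.log ((n : ℝ) + 2) ≤ Real.log (((n + 1 : ℕ) : ℝ) + 2) :=
      Real.log_le_log (by positivity) (by push_cast; linarith)
    set x := ((n + 1 : ℕ) : ℝ) + 2
    set p := Real.log ((n : ℝ) + 2)
    set q := Real.log x
    calc (x * q ^ 2)⁻¹ = x⁻¹ * (q * q)⁻¹ := by rw [mul_inv, sq]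
      _ ≤ (q - p) * (p * q)⁻¹ := by gcongr
      _ = p⁻¹ - q⁻¹ := by field_simp
  calc _ ≤ ∑ n ∈ Finset.range N,
        ((Real.log ((n : ℝ) + 2))⁻¹ - (Real.log (((n + 1 : ℕ) : ℝ) + 2))⁻¹) :=
        Finset.sum_le_sum fun n _ => key n
    _ = (Real.log (((0 : ℕ) : ℝ) + 2))⁻¹ - (Real.log ((N : ℝ) + 2))⁻¹ :=
        Finset.sum_range_sub' (fun n : ℕ => (Real.log ((n : ℝ) + 2))⁻¹) N
    _ ≤ _ := by
        have := inv_nonneg.mpr (hl N).le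
        simp only [Nat.cast_zero, zero_add]
        linarith

lemma inv_mul_log_sub_nonneg (n : ℕ) :
    0 ≤ (((n : ℝ) + 2) * Real.log ((n : ℝ) + 2))⁻¹ -
      (((n : ℝ) + 3) * Real.log ((n : ℝ) + 3))⁻¹ := by
  have ha := log_add_two_pos n
  have hab : Real.log ((n : ℝ) + 2) ≤ Real.log ((n : ℝ) + 3) :=
    Real.log_le_log (by positivity) (by linarith)
  rw [sub_nonneg]
  gcongr
  norm_num

lemma inv_mul_log_sub_le (n : ℕ) :
    (((n : ℝ) + 2) * Real.log ((n : ℝ) + 2))⁻¹ - (((n : ℝ) + 3) * Real.log ((n : ℝ) + 3))⁻¹ ≤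
      3 * (((n : ℝ) + 2) ^ 2 * Real.log ((n : ℝ) + 2))⁻¹ := by
  have ha := log_add_two_pos n
  have hab : Real.log ((n : ℝ) + 2) ≤ Real.log ((n : ℝ) + 3) :=
    Real.log_le_log (by positivity) (by linarith)
  have h1 := log_add_one_sub_log_le_inv (x := (n : ℝ) + 2) (by positivity)
  rw [show (n : ℝ) + 2 + 1 = (n : ℝ) + 3 by ring] at h1
  have hl2 : 1 / 2 ≤ Real.log ((n : ℝ) + 2) := by
    have : Real.log 2 ≤ Real.log ((n : ℝ) + 2) :=
      Real.log_le_log (by norm_num) (by linarith [Nat.cast_nonneg (α := ℝ) n])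
    linarith [Real.log_two_gt_d9]
  have hx : 2 ≤ (n : ℝ) + 2 := by linarith [Nat.cast_nonneg (α := ℝ) n]
  have e : (n : ℝ) + 3 = ((n : ℝ) + 2) + 1 := by ring
  rw [e] at h1 hab ⊢
  generalize (n : ℝ) + 2 = x at *
  set p := Real.log x
  set q := Real.log (x + 1)
  have hx0 : 0 < x := by linarith
  have hq : 0 < q := by linarith
  calc (x * p)⁻¹ - ((x + 1) * q)⁻¹ = (x * (x + 1) * p)⁻¹ + (x + 1)⁻¹ * ((q - p) * (p * q)⁻¹) := by
        field_simp; ring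
    _ ≤ (x * x * p)⁻¹ + x⁻¹ * (x⁻¹ * (p * (1 / 2))⁻¹) := by
        gcongr
        · linarith
        · linarith
        · linarith
    _ = _ := by field_simp; ring

/-- Growth bound at a single point for a slowly varying sequence, from a bound in mean square. -/
lemma abs_pow_three_le {T : ℕ → ℝ} {B : ℝ} (h0 : T 0 = 0)
    (hd : ∀ j : ℕ, |T (j + 1) - T j| ≤ Real.log ((j : ℝ) + 2) ^ 2)
    (hB : ∀ N : ℕ, ∑ n ∈ Finset.range N, T n ^ 2 / ((n : ℝ) + 2) ^ 3 ≤ B) (m : ℕ) :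
    |T m| ^ 3 ≤ 5 * B * (Real.log ((m : ℝ) + 2) ^ 2 * ((m : ℝ) + 2) ^ 3) +
      3 * (((m : ℝ) + 2) * Real.log ((m : ℝ) + 2) ^ 6) := by
  set l := Real.log ((m : ℝ) + 2) ^ 2 with hl
  have hl0 : 0 ≤ l := by positivity
  have step (j : ℕ) (hj : j ≤ m) :
      |T j| ^ 3 ≤ ∑ i ∈ Finset.range j, (5 * l * T i ^ 2 + 3 * l ^ 3) := by
    induction j with
    | zero => simp [h0]
    | succ j ih =>
      rw [Finset.sum_range_succ]
      have h1 := ih (by omega)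
      have h2 : |T (j + 1) - T j| ≤ l := by
        refine (hd j).trans ?_
        rw [hl]
        have : (j : ℝ) ≤ m := by exact_mod_cast (by omega : j ≤ m)
        have := (log_add_two_pos j).le
        gcongr
      have h3 : |T (j + 1)| ≤ |T j| + l := by
        have := abs_sub_abs_le_abs_sub (T (j + 1)) (T j)
        linarith
      have h4 : |T (j + 1)| ^ 3 ≤ (|T j| + l) ^ 3 := by gcongr
      have hx := abs_nonneg (T j)
      rw [← sq_abs (T j)]
      nlinarith [mul_nonneg hl0 (sq_nonneg (|T j| - l)), mul_nonneg hl0 (sq_nonneg (|T j|)),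
        pow_nonneg hl0 3]
  refine (step m le_rfl).trans ?_
  rw [Finset.sum_add_distrib, ← Finset.mul_sum, Finset.sum_const, Finset.card_range, nsmul_eq_mul]
  have h1 : ∑ i ∈ Finset.range m, T i ^ 2 ≤ ((m : ℝ) + 2) ^ 3 * B := by
    refine le_trans ?_ (mul_le_mul_of_nonneg_left (hB m) (by positivity))
    rw [Finset.mul_sum]
    refine Finset.sum_le_sum fun i hi => ?_
    have : (i : ℝ) ≤ m := by exact_mod_cast (Finset.mem_range.mp hi).le
    rw [mul_div_assoc', le_div_iff₀ (by positivity), mul_comm]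
    gcongr
  have e : l ^ 3 = Real.log ((m : ℝ) + 2) ^ 6 := by rw [hl]; ring
  have h2 : 5 * l * ∑ i ∈ Finset.range m, T i ^ 2 ≤ 5 * l * (((m : ℝ) + 2) ^ 3 * B) := by gcongr
  have h3 : 0 ≤ l ^ 3 := by positivity
  rw [← e]
  nlinarith

lemma tendsto_div_mul_log {T : ℕ → ℝ} {B : ℝ} (h0 : T 0 = 0)
    (hd : ∀ j : ℕ, |T (j + 1) - T j| ≤ Real.log ((j : ℝ) + 2) ^ 2)
    (hB : ∀ N : ℕ, ∑ n ∈ Finset.range N, T n ^ 2 / ((n : ℝ) + 2) ^ 3 ≤ B) :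
    Tendsto (fun n : ℕ => T n * (((n : ℝ) + 2) * Real.log ((n : ℝ) + 2))⁻¹) atTop (nhds 0) := by
  have hx : Tendsto (fun n : ℕ => (n : ℝ) + 2) atTop atTop :=
    tendsto_atTop_add_const_right _ _ tendsto_natCast_atTop_atTop
  have h1 : Tendsto (fun n : ℕ => 5 * B * (Real.log ((n : ℝ) + 2))⁻¹) atTop (nhds 0) := by
    have := (tendsto_inv_atTop_zero.comp (Real.tendsto_log_atTop.comp hx)).const_mul (5 * B)
    rwa [mul_zero] at this
  have h2 : Tendsto (fun n : ℕ => 3 * (Real.log ((n : ℝ) + 2) ^ 3 / ((n : ℝ) + 2) ^ 2)) atTop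
      (nhds 0) := by
    have h := (isLittleO_log_rpow_rpow_atTop (s := 2) (3 : ℝ) (by norm_num)).tendsto_div_nhds_zero
    have := (h.comp hx).const_mul 3
    rw [mul_zero] at this
    refine this.congr fun n => ?_
    simp only [Function.comp]
    norm_cast
  have h3 : Tendsto (fun n : ℕ => |T n * (((n : ℝ) + 2) * Real.log ((n : ℝ) + 2))⁻¹| ^ 3) atTop
      (nhds 0) := by
    have h12 := h1.add h2
    rw [add_zero] at h12
    refine squeeze_zero (fun n => by positivity) (fun n => ?_) h12
    have hl := log_add_two_pos n
    have hc := abs_pow_three_le h0 hd hB n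
    have hx0 : (0 : ℝ) < (n : ℝ) + 2 := by positivity
    generalize (n : ℝ) + 2 = x at *
    set l := Real.log x
    rw [abs_mul, mul_pow, abs_of_pos (by positivity : 0 < (x * l)⁻¹), inv_pow, ← div_eq_mul_inv,
      div_le_iff₀ (by positivity)]
    refine hc.trans (le_of_eq ?_)
    field_simp
  rw [tendsto_zero_iff_abs_tendsto_zero]
  have h4 := h3.rpow_const (p := (1 / 3 : ℝ)) (Or.inr (by norm_num))
  rw [Real.zero_rpow (by norm_num)] at h4
  refine h4.congr fun n => ?_
  rw [← Real.rpow_natCast, ← Real.rpow_mul (abs_nonneg _)]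
  norm_num

lemma exists_tendsto_sum_sub_mul_inv {T : ℕ → ℝ} {B : ℝ} (h0 : T 0 = 0)
    (hd : ∀ j : ℕ, |T (j + 1) - T j| ≤ Real.log ((j : ℝ) + 2) ^ 2)
    (hB : ∀ N : ℕ, ∑ n ∈ Finset.range N, T n ^ 2 / ((n : ℝ) + 2) ^ 3 ≤ B) :
    ∃ ℓ : ℝ, Tendsto (fun N : ℕ => ∑ n ∈ Finset.range N,
      (T (n + 1) - T n) * (((n : ℝ) + 2) * Real.log ((n : ℝ) + 2))⁻¹) atTop (nhds ℓ) := by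
  have habel (N : ℕ) : ∑ n ∈ Finset.range N,
      (T (n + 1) - T n) * (((n : ℝ) + 2) * Real.log ((n : ℝ) + 2))⁻¹ =
      T N * (((N : ℝ) + 2) * Real.log ((N : ℝ) + 2))⁻¹ + ∑ n ∈ Finset.range N, T (n + 1) *
        ((((n : ℝ) + 2) * Real.log ((n : ℝ) + 2))⁻¹ -
          (((n : ℝ) + 3) * Real.log ((n : ℝ) + 3))⁻¹) := by
    induction N with
    | zero => simp [h0]
    | succ N ih =>
      rw [Finset.sum_range_succ, ih, Finset.sum_range_succ]
      have e : ((N + 1 : ℕ) : ℝ) + 2 = (N : ℝ) + 3 := by push_cast; ring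
      rw [e]
      ring
  have hs1 : Summable fun n : ℕ => T n ^ 2 / ((n : ℝ) + 2) ^ 3 :=
    summable_of_sum_range_le (fun n => by positivity) hB
  have hs2 := (summable_nat_add_iff 1).mpr hs1
  have hs3 := (hs2.mul_left 12).add (summable_inv_mul_log_sq.mul_left 3)
  have hs : Summable fun n : ℕ => T (n + 1) *
        ((((n : ℝ) + 2) * Real.log ((n : ℝ) + 2))⁻¹ -
          (((n : ℝ) + 3) * Real.log ((n : ℝ) + 3))⁻¹) := by
    refine hs3.of_norm_bounded fun n => ?_
    rw [norm_mul, Real.norm_eq_abs, Real.norm_of_nonneg (inv_mul_log_sub_nonneg n)]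
    refine (mul_le_mul_of_nonneg_left (inv_mul_log_sub_le n) (abs_nonneg _)).trans ?_
    have hl := log_add_two_pos n
    have e : ((n + 1 : ℕ) : ℝ) + 2 = ((n : ℝ) + 2) + 1 := by push_cast; ring
    have hx2 : 2 ≤ (n : ℝ) + 2 := by linarith [Nat.cast_nonneg (α := ℝ) n]
    rw [e, ← sq_abs (T (n + 1))]
    have ht := abs_nonneg (T (n + 1))
    generalize (n : ℝ) + 2 = x at *
    generalize |T (n + 1)| = t at *
    set l := Real.log x
    have hx : 0 < x := by linarith
    have h1 : t ^ 2 / x ^ 3 ≤ 8 * (t ^ 2 / (x + 1) ^ 3) := by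
      rw [mul_div_assoc', div_le_div_iff₀ (by positivity) (by positivity)]
      have : (x + 1) ^ 3 ≤ (2 * x) ^ 3 := by gcongr; linarith
      nlinarith [sq_nonneg t]
    have h2 : t * (x ^ 2 * l)⁻¹ ≤ (t ^ 2 / x ^ 3 + (x * l ^ 2)⁻¹) / 2 := by
      have e2 : (t ^ 2 / x ^ 3 + (x * l ^ 2)⁻¹) / 2 - t * (x ^ 2 * l)⁻¹ =
          (t / x - l⁻¹) ^ 2 / (2 * x) := by field_simp; ring
      have : 0 ≤ (t / x - l⁻¹) ^ 2 / (2 * x) := by positivity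
      linarith
    have h3 : 0 ≤ (x * l ^ 2)⁻¹ := by positivity
    linarith
  refine ⟨0 + _, ((tendsto_div_mul_log h0 hd hB).add hs.hasSum.tendsto_sum_nat).congr
    fun N => (habel N).symm⟩

lemma moebiusLogSqSum_succ (n : ℕ) : moebiusLogSqSum (n + 1) =
    moebiusLogSqSum n + (moebius (n + 1) : ℝ) * Real.log ((n : ℝ) + 1) ^ 2 := by
  rw [moebiusLogSqSum, Finset.sum_Icc_succ_top (by omega)]
  push_cast
  rfl

lemma exists_tendsto_sum_range_moebius_mul_log_div :
    ∃ ℓ : ℝ, Tendsto (fun N : ℕ => ∑ n ∈ Finset.range N,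
      (moebius (n + 2) : ℝ) * Real.log ((n : ℝ) + 2) / ((n : ℝ) + 2)) atTop (nhds ℓ) := by
  obtain ⟨B, hB⟩ := exists_sum_moebiusLogSqSum_sq_le
  have hsub (n : ℕ) : moebiusLogSqSum (n + 1 + 1) - moebiusLogSqSum (n + 1) =
      (moebius (n + 2) : ℝ) * Real.log ((n : ℝ) + 2) ^ 2 := by
    rw [moebiusLogSqSum_succ (n + 1), add_sub_cancel_left]
    push_cast
    rw [show (n : ℝ) + 1 + 1 = n + 2 by ring]
  have hd (j : ℕ) : |moebiusLogSqSum (j + 1 + 1) - moebiusLogSqSum (j + 1)| ≤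
      Real.log ((j : ℝ) + 2) ^ 2 := by
    rw [hsub, abs_mul, abs_of_nonneg (sq_nonneg (Real.log _))]
    refine mul_le_of_le_one_left (sq_nonneg _) ?_
    exact_mod_cast abs_moebius_le_one
  obtain ⟨ℓ, hℓ⟩ := exists_tendsto_sum_sub_mul_inv (T := fun n => moebiusLogSqSum (n + 1)) (B := B)
    (by simp [moebiusLogSqSum]) hd hB
  refine ⟨ℓ, hℓ.congr fun N => Finset.sum_congr rfl fun n _ => ?_⟩
  have := (log_add_two_pos n).ne'
  rw [hsub]
  field_simp

lemma exists_tendsto_sum_range_moebius_div :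
    ∃ ℓ : ℝ, Tendsto (fun N : ℕ => ∑ n ∈ Finset.range N,
      (moebius (n + 2) : ℝ) / ((n : ℝ) + 2)) atTop (nhds ℓ) := by
  obtain ⟨ℓ, hℓ⟩ := exists_tendsto_sum_range_moebius_mul_log_div
  obtain ⟨b, hb⟩ := hℓ.norm.bddAbove_range
  have hx : Tendsto (fun n : ℕ => (n : ℝ) + 2) atTop atTop :=
    tendsto_atTop_add_const_right _ _ tendsto_natCast_atTop_atTop
  have hc := Antitone.cauchySeq_series_mul_of_tendsto_zero_of_bounded
    (f := fun n : ℕ => (Real.log ((n : ℝ) + 2))⁻¹) (b := b)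
    (z := fun n : ℕ => (moebius (n + 2) : ℝ) * Real.log ((n : ℝ) + 2) / ((n : ℝ) + 2))
    (fun m n hmn => by
      have := log_add_two_pos m
      have : (m : ℝ) ≤ n := by exact_mod_cast hmn
      dsimp only
      gcongr)
    (tendsto_inv_atTop_zero.comp (Real.tendsto_log_atTop.comp hx))
    (fun n => hb ⟨n, rfl⟩)
  obtain ⟨m, hm⟩ := cauchySeq_tendsto_of_complete hc
  refine ⟨m, hm.congr fun N => Finset.sum_congr rfl fun n _ => ?_⟩
  have := (log_add_two_pos n).ne'
  rw [smul_eq_mul]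
  field_simp

open MeasureTheory in
lemma norm_LSeries_ofReal_le {f : ℕ → ℂ} {M ε δ : ℝ} {T : ℕ} (hδ : 0 < δ)
    (hM : 0 ≤ M) (hε : 0 ≤ ε)
    (hf : LSeriesSummable f δ) (hb : ∀ n, ‖∑ k ∈ Finset.Icc 1 n, f k‖ ≤ M)
    (ht : ∀ n, T ≤ n → ‖∑ k ∈ Finset.Icc 1 n, f k‖ ≤ ε) :
    ‖LSeries f δ‖ ≤ ε + δ * (M * T) := by
  have hO : (fun n ↦ ∑ k ∈ Finset.Icc 1 n, f k) =O[atTop] fun n ↦ (n : ℝ) ^ (0 : ℝ) := by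
    refine Asymptotics.IsBigO.of_bound M (Eventually.of_forall fun n => ?_)
    simpa using hb n
  rw [LSeries_eq_mul_integral f le_rfl (s := (δ : ℂ)) (by simpa using hδ) hf hO, norm_mul,
    Complex.norm_real, Real.norm_of_nonneg hδ.le]
  have hpow : IntegrableOn (fun t : ℝ => ε * t ^ (-(δ + 1))) (Set.Ioi 1) :=
    (integrableOn_Ioi_rpow_of_lt (by linarith) one_pos).const_mul _
  have hind : IntegrableOn ((Set.Ioc (0 : ℝ) T).indicator fun _ => M) (Set.Ioi 1) := by
    refine Integrable.integrableOn ?_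
    rw [integrable_indicator_iff measurableSet_Ioc]
    exact integrableOn_const (by simp)
  have hbound : ‖∫ t in Set.Ioi (1 : ℝ), (∑ k ∈ Finset.Icc 1 ⌊t⌋₊, f k) * (t : ℂ) ^ (-((δ : ℂ) + 1))‖
      ≤ ∫ t in Set.Ioi (1 : ℝ),
        (ε * t ^ (-(δ + 1)) + (Set.Ioc (0 : ℝ) T).indicator (fun _ => M) t) := by
    refine norm_integral_le_of_norm_le (hpow.add hind) ?_
    filter_upwards [ae_restrict_mem measurableSet_Ioi] with t ht1
    have ht1 : 1 < t := ht1
    have ht0 : 0 < t := by linarith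
    have e : ‖(t : ℂ) ^ (-((δ : ℂ) + 1))‖ = t ^ (-(δ + 1)) := by
      rw [Complex.norm_cpow_eq_rpow_re_of_pos ht0]; simp
    rw [norm_mul, e]
    have hp0 : 0 ≤ t ^ (-(δ + 1)) := by positivity
    have hp1 : t ^ (-(δ + 1)) ≤ 1 := Real.rpow_le_one_of_one_le_of_nonpos ht1.le (by linarith)
    by_cases h : t ≤ T
    · rw [Set.indicator_of_mem (show t ∈ Set.Ioc (0 : ℝ) T from ⟨ht0, h⟩)]
      have h1 := mul_le_mul (hb ⌊t⌋₊) hp1 hp0 hM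
      have h2 := mul_nonneg hε hp0
      linarith
    · rw [Set.indicator_of_notMem (show t ∉ Set.Ioc (0 : ℝ) T from fun hh => h hh.2), add_zero]
      gcongr
      exact ht _ (Nat.le_floor (not_le.mp h).le)
  have hI1 : ∫ t in Set.Ioi (1 : ℝ), ε * t ^ (-(δ + 1)) = ε / δ := by
    rw [integral_const_mul, integral_Ioi_rpow_of_lt (by linarith) one_pos, Real.one_rpow]
    rw [show -(δ + 1) + 1 = -δ by ring, neg_div_neg_eq, mul_one_div]
  have hI2 : ∫ t in Set.Ioi (1 : ℝ), (Set.Ioc (0 : ℝ) T).indicator (fun _ => M) t ≤ M * T := by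
    have h0 : ∀ t, 0 ≤ (Set.Ioc (0 : ℝ) T).indicator (fun _ => M) t := fun t =>
      Set.indicator_nonneg (fun _ _ => hM) t
    have hi : Integrable ((Set.Ioc (0 : ℝ) T).indicator fun _ => M) := by
      rw [integrable_indicator_iff measurableSet_Ioc]
      exact integrableOn_const (by simp)
    refine (setIntegral_le_integral hi (Eventually.of_forall h0)).trans (le_of_eq ?_)
    rw [integral_indicator measurableSet_Ioc]
    simp [mul_comm]
  calc _ ≤ δ * (ε / δ + M * T) := by
        gcongr
        refine hbound.trans ?_
        rw [integral_add hpow hind, hI1]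
        gcongr
    _ = _ := by field_simp

/-- Abel's theorem for Dirichlet series. -/
lemma tendsto_LSeries_ofReal_nhdsGT_zero_of_tendsto_zero {f : ℕ → ℂ}
    (hf : ∀ δ : ℝ, 0 < δ → LSeriesSummable f δ)
    (h : Tendsto (fun N : ℕ => ∑ k ∈ Finset.Icc 1 N, f k) atTop (nhds 0)) :
    Tendsto (fun δ : ℝ => LSeries f δ) (nhdsWithin 0 (Set.Ioi 0)) (nhds 0) := by
  obtain ⟨M, hM⟩ := h.norm.bddAbove_range
  have hb : ∀ n, ‖∑ k ∈ Finset.Icc 1 n, f k‖ ≤ M := fun n => hM ⟨n, rfl⟩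
  have hM0 : 0 ≤ M := (norm_nonneg _).trans (hb 0)
  rw [Metric.tendsto_nhds]
  intro ε hε
  obtain ⟨T, hT⟩ := Metric.tendsto_atTop.mp h (ε / 2) (by positivity)
  have ht : ∀ n, T ≤ n → ‖∑ k ∈ Finset.Icc 1 n, f k‖ ≤ ε / 2 := fun n hn => by
    simpa using (hT n hn).le
  have hlim : Tendsto (fun δ : ℝ => ε / 2 + δ * (M * T)) (nhdsWithin 0 (Set.Ioi 0))
      (nhds (ε / 2 + 0 * (M * T))) :=
    tendsto_nhdsWithin_of_tendsto_nhds (Continuous.tendsto (by fun_prop) 0)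
  have hlt : ε / 2 + 0 * (M * T) < ε := by linarith
  filter_upwards [hlim.eventually_lt_const hlt, self_mem_nhdsWithin] with δ h1 h2
  rw [dist_zero_right]
  exact (norm_LSeries_ofReal_le h2 hM0 (by positivity) (hf δ h2) hb ht).trans_lt h1

lemma tendsto_LSeries_ofReal_nhdsGT_zero {f : ℕ → ℂ} {ℓ : ℂ}
    (hf : ∀ δ : ℝ, 0 < δ → LSeriesSummable f δ)
    (h : Tendsto (fun N : ℕ => ∑ k ∈ Finset.Icc 1 N, f k) atTop (nhds ℓ)) :
    Tendsto (fun δ : ℝ => LSeries f δ) (nhdsWithin 0 (Set.Ioi 0)) (nhds ℓ) := by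
  have hδs (δ : ℝ) : LSeriesSummable (ℓ • LSeries.delta) δ := by
    refine LSeriesSummable.smul _ ?_
    exact (hasSum_ite_eq (1 : ℕ) (1 : ℂ)).summable.congr fun n => (LSeries.term_delta _ n).symm
  have h1 := tendsto_LSeries_ofReal_nhdsGT_zero_of_tendsto_zero
    (f := f - ℓ • LSeries.delta) (fun δ hδ => (hf δ hδ).sub (hδs δ)) (by
      have h2 := h.sub_const ℓ
      rw [sub_self] at h2
      refine h2.congr' ?_
      filter_upwards [eventually_ge_atTop 1] with N hN
      simp only [Pi.sub_apply, Finset.sum_sub_distrib, Pi.smul_apply, LSeries.delta, smul_eq_mul,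
        mul_ite, mul_one, mul_zero, Finset.sum_ite_eq', Finset.mem_Icc, le_refl, hN, true_and,
        if_true])
  have h3 := h1.add_const ℓ
  rw [zero_add] at h3
  refine h3.congr' ?_
  filter_upwards [self_mem_nhdsWithin] with δ hδ
  rw [LSeries_sub (hf δ hδ) (hδs δ), LSeries_smul, LSeries_delta]
  simp

lemma term_div_natCast (a : ℕ → ℂ) (s : ℂ) :
    LSeries.term (fun n => a n / n) s = LSeries.term a (1 + s) := by
  ext n
  rcases eq_or_ne n 0 with rfl | hn
  · simp
  · have : (n : ℂ) ≠ 0 := by exact_mod_cast hn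
    rw [LSeries.term_of_ne_zero hn, LSeries.term_of_ne_zero hn, Complex.cpow_add _ _ this,
      Complex.cpow_one, div_div]

/-- Partial sums of `∑ a n / n`, if convergent, converge to the limit of the L-series at `1`. -/
lemma eq_of_tendsto_sum_div_of_tendsto_LSeries {a : ℕ → ℂ} {ℓ ℓ' : ℂ}
    (ha : ∀ s : ℂ, 1 < s.re → LSeriesSummable a s)
    (h : Tendsto (fun N : ℕ => ∑ k ∈ Finset.Icc 1 N, a k / k) atTop (nhds ℓ))
    (h' : Tendsto (fun δ : ℝ => LSeries a (1 + δ)) (nhdsWithin 0 (Set.Ioi 0)) (nhds ℓ')) :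
    ℓ = ℓ' := by
  have h1 := tendsto_LSeries_ofReal_nhdsGT_zero (f := fun n => a n / n) (fun δ hδ => by
    rw [LSeriesSummable, term_div_natCast]
    exact ha _ (by simpa using hδ)) h
  refine tendsto_nhds_unique (h1.congr fun δ => ?_) h'
  rw [LSeries, LSeries, term_div_natCast]

lemma tendsto_sum_Icc_of_tendsto_sum_range_add_two {g : ℕ → ℝ} {ℓ : ℝ}
    (h : Tendsto (fun N : ℕ => ∑ n ∈ Finset.range N, g (n + 2)) atTop (nhds ℓ)) :
    Tendsto (fun N : ℕ => ∑ n ∈ Finset.Icc 1 N, (g n : ℂ)) atTop (nhds ((g 1 + ℓ : ℝ) : ℂ)) := by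
  rw [← tendsto_add_atTop_iff_nat 1]
  have h1 := (Complex.continuous_ofReal.tendsto _).comp (h.const_add (g 1))
  refine h1.congr fun N => ?_
  simp only [Function.comp]
  rw [← Complex.ofReal_sum]
  congr 1
  induction N with
  | zero => simp
  | succ N ih =>
    rw [Finset.sum_range_succ, ← add_assoc, ih]
    exact (Finset.sum_Icc_succ_top (by omega) g).symm

lemma tendsto_one_add_ofReal_nhdsGT :
    Tendsto (fun δ : ℝ => (1 + δ : ℂ)) (nhdsWithin 0 (Set.Ioi 0)) (nhds 1) := by
  refine tendsto_nhdsWithin_of_tendsto_nhds ?_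
  have : Continuous fun δ : ℝ => (1 + δ : ℂ) := by fun_prop
  simpa using this.tendsto 0

lemma inv_riemannZeta_eq {s : ℂ} (hs : 1 < s.re) :
    (riemannZeta s)⁻¹ = (s - 1) / riemannZeta₁ s := by
  have : s ≠ 1 := by rintro rfl; simp at hs
  rw [riemannZeta_eq_inv_sub_mul this, mul_inv, inv_inv, div_eq_mul_inv]

lemma tendsto_sum_moebius_div :
    Tendsto (fun N : ℕ => ∑ n ∈ Finset.Icc 1 N, (moebius n : ℂ) / n) atTop (nhds 0) := by
  obtain ⟨ℓ, hℓ⟩ := exists_tendsto_sum_range_moebius_div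
  have h := tendsto_sum_Icc_of_tendsto_sum_range_add_two (g := fun n => (moebius n : ℝ) / n)
    (hℓ.congr fun N => Finset.sum_congr rfl fun n _ => by push_cast; rfl)
  simp only [Complex.ofReal_div, Complex.ofReal_intCast,
    Complex.ofReal_natCast] at h
  suffices hlim : Tendsto (fun δ : ℝ => LSeries (fun n => (moebius n : ℂ)) (1 + δ))
      (nhdsWithin 0 (Set.Ioi 0)) (nhds 0) by
    rwa [eq_of_tendsto_sum_div_of_tendsto_LSeries (a := fun n => (moebius n : ℂ))
      (fun s hs => LSeriesSummable_moebius_iff.mpr hs) h hlim] at h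
  have hc : ContinuousAt (fun s => (s - 1) / riemannZeta₁ s) 1 :=
    (by fun_prop : ContinuousAt (fun s : ℂ => s - 1) 1).div
      differentiable_riemannZeta₁.continuous.continuousAt (riemannZeta₁_ne_zero (by simp))
  have h1 := hc.tendsto.comp tendsto_one_add_ofReal_nhdsGT
  simp only [sub_self, zero_div] at h1
  refine h1.congr' ?_
  filter_upwards [self_mem_nhdsWithin] with δ hδ
  have hre : 1 < (1 + δ : ℂ).re := by simpa using hδ
  rw [LSeries_moebius_eq_inv hre, inv_riemannZeta_eq hre]
  rfl

lemma tendsto_sum_moebius_mul_log_div :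
    Tendsto (fun N : ℕ => ∑ n ∈ Finset.Icc 1 N, (moebius n : ℂ) * (Real.log n : ℂ) / n) atTop
      (nhds (-1)) := by
  obtain ⟨ℓ, hℓ⟩ := exists_tendsto_sum_range_moebius_mul_log_div
  have h := tendsto_sum_Icc_of_tendsto_sum_range_add_two
    (g := fun n => (moebius n : ℝ) * Real.log n / n)
    (hℓ.congr fun N => Finset.sum_congr rfl fun n _ => by push_cast; rfl)
  simp only [Complex.ofReal_div, Complex.ofReal_mul, Complex.ofReal_intCast,
    Complex.ofReal_natCast] at h
  have hlm : (LSeries.logMul fun n => (moebius n : ℂ)) =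
      fun n : ℕ => (moebius n : ℂ) * (Real.log n : ℂ) := by
    ext n
    rw [LSeries.logMul, ← Complex.natCast_log, mul_comm]
  have habs {s : ℂ} (hs : 1 < s.re) :
      LSeries.abscissaOfAbsConv (fun n => (moebius n : ℂ)) < s.re := by
    rw [abscissaOfAbsConv_moebius]; exact_mod_cast hs
  suffices hlim : Tendsto
      (fun δ : ℝ => LSeries (fun n : ℕ => (moebius n : ℂ) * (Real.log n : ℂ)) (1 + δ))
      (nhdsWithin 0 (Set.Ioi 0)) (nhds (-1)) by
    rwa [eq_of_tendsto_sum_div_of_tendsto_LSeries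
      (a := fun n => (moebius n : ℂ) * (Real.log n : ℂ))
      (fun s hs => hlm ▸ LSeriesSummable_logMul_of_lt_re (habs hs)) h hlim] at h
  set q : ℂ → ℂ := fun s => (s - 1) / riemannZeta₁ s with hq
  set q' : ℂ → ℂ := fun s =>
    (1 * riemannZeta₁ s - (s - 1) * deriv riemannZeta₁ s) / riemannZeta₁ s ^ 2 with hq'
  have hc : ContinuousAt q' 1 := by
    have h1 := differentiable_riemannZeta₁.continuous
    have h2 : Continuous (deriv riemannZeta₁) :=
      (differentiable_riemannZeta₁.contDiff (n := 1)).continuous_deriv le_rfl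
    refine ContinuousAt.div (by fun_prop) (by fun_prop) ?_
    exact pow_ne_zero 2 (riemannZeta₁_ne_zero (by simp))
  have hd {s : ℂ} (hs : 1 < s.re) : HasDerivAt q (q' s) s :=
    ((hasDerivAt_id s).sub_const 1).div (differentiable_riemannZeta₁ s).hasDerivAt
      (riemannZeta₁_ne_zero hs.le)
  have h1 := (hc.tendsto.comp tendsto_one_add_ofReal_nhdsGT).neg
  have e1 : q' 1 = 1 := by simp [hq']
  rw [e1] at h1
  refine h1.congr' ?_
  filter_upwards [self_mem_nhdsWithin] with δ hδ
  have hre : 1 < (1 + δ : ℂ).re := by simpa using hδ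
  have hU : {z : ℂ | 1 < z.re} ∈ nhds (1 + δ : ℂ) :=
    (isOpen_lt continuous_const Complex.continuous_re).mem_nhds hre
  have h2 := LSeries_deriv (habs hre)
  have he : LSeries (fun n => (moebius n : ℂ)) =ᶠ[nhds (1 + δ : ℂ)] q := by
    filter_upwards [hU] with z hz
    rw [LSeries_moebius_eq_inv hz, inv_riemannZeta_eq hz]
  rw [he.deriv_eq, (hd hre).deriv, hlm] at h2
  simp only [Function.comp]
  rw [h2, neg_neg]

lemma tendsto_sum_moebius_div_pow (k : ℕ) :
    Tendsto (fun N : ℕ => ∑ n ∈ Finset.Icc 1 N, (moebius n : ℂ) / (n : ℂ) ^ (k + 2)) atTop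
      (nhds (riemannZeta ((k : ℂ) + 2))⁻¹) := by
  have hre : 1 < ((k : ℂ) + 2).re := by
    simp only [Complex.add_re, Complex.natCast_re, Complex.re_ofNat]
    linarith [Nat.cast_nonneg (α := ℝ) k]
  have h := (LSeriesSummable_moebius_iff.mpr hre).hasSum.tendsto_sum_nat
  rw [← LSeries, LSeries_moebius_eq_inv hre] at h
  refine ((tendsto_add_atTop_iff_nat 1).mpr h).congr fun N => ?_
  have hsub : Finset.Icc 1 N ⊆ Finset.range (N + 1) := fun n hn => by
    rw [Finset.mem_Icc] at hn; rw [Finset.mem_range]; omega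
  rw [← Finset.sum_subset hsub]
  · refine Finset.sum_congr rfl fun n hn => ?_
    rw [Finset.mem_Icc] at hn
    rw [LSeries.term_of_ne_zero (by omega)]
    congr 1
    exact_mod_cast Complex.cpow_natCast (n : ℂ) (k + 2)
  · intro n hn hn'
    rw [Finset.mem_range] at hn
    rw [Finset.mem_Icc] at hn'
    obtain rfl : n = 0 := by omega
    simp

lemma norm_sum_moebius_div_pow_le (k N : ℕ) :
    ‖∑ n ∈ Finset.Icc 1 N, (moebius n : ℂ) / (n : ℂ) ^ (k + 2)‖ ≤ ∑' n : ℕ, 1 / (n : ℝ) ^ 2 := by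
  have hs : Summable fun n : ℕ => 1 / (n : ℝ) ^ 2 :=
    Real.summable_one_div_nat_pow.mpr one_lt_two
  refine (norm_sum_le _ _).trans (le_trans (Finset.sum_le_sum fun n hn => ?_)
    (hs.sum_le_tsum (Finset.Icc 1 N) fun n _ => by positivity))
  rw [Finset.mem_Icc] at hn
  have hn1 : (1 : ℝ) ≤ n := by exact_mod_cast hn.1
  rw [norm_div, norm_pow, Complex.norm_natCast]
  gcongr
  · rw [Complex.norm_intCast]
    exact_mod_cast abs_moebius_le_one
  · omega

lemma summable_pow_div_mul_factorial (L : ℝ) :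
    Summable fun k : ℕ => L ^ (k + 1) / ((k + 1 : ℝ) * (Nat.factorial (k + 1) : ℝ)) := by
  have h := (summable_nat_add_iff 1).mpr (Real.summable_pow_div_factorial |L|)
  refine h.of_norm_bounded fun k => ?_
  rw [norm_div, norm_pow, Real.norm_eq_abs, Real.norm_of_nonneg (by positivity)]
  gcongr
  refine le_mul_of_one_le_left (by positivity) ?_
  linarith [Nat.cast_nonneg (α := ℝ) k]

lemma moebius_div_mul_li_eq {L : ℝ} (hL : 0 < L) {n : ℕ} (hn : n ≠ 0) (γ : ℝ) :
    ((moebius n : ℂ) / (n : ℂ)) * ((γ + Real.log (L / n) +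
      ∑' k : ℕ, (L / n) ^ (k + 1) / ((k + 1 : ℝ) * (Nat.factorial (k + 1) : ℝ)) : ℝ) : ℂ) =
    ((γ + Real.log L : ℝ) : ℂ) * ((moebius n : ℂ) / n) -
      (moebius n : ℂ) * (Real.log n : ℂ) / n +
      ∑' k : ℕ, ((L ^ (k + 1) / ((k + 1 : ℝ) * (Nat.factorial (k + 1) : ℝ)) : ℝ) : ℂ) *
        ((moebius n : ℂ) / (n : ℂ) ^ (k + 2)) := by
  have hn' : (n : ℂ) ≠ 0 := by exact_mod_cast hn
  have hnr : (n : ℝ) ≠ 0 := by exact_mod_cast hn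
  have e : ∑' k : ℕ, ((L ^ (k + 1) / ((k + 1 : ℝ) * (Nat.factorial (k + 1) : ℝ)) : ℝ) : ℂ) *
        ((moebius n : ℂ) / (n : ℂ) ^ (k + 2)) = ((moebius n : ℂ) / (n : ℂ)) *
      ((∑' k : ℕ, (L / n) ^ (k + 1) / ((k + 1 : ℝ) * (Nat.factorial (k + 1) : ℝ)) : ℝ) : ℂ) := by
    rw [Complex.ofReal_tsum, ← tsum_mul_left]
    refine tsum_congr fun k => ?_
    push_cast
    rw [div_pow, pow_succ (n : ℂ) (k + 1)]
    field_simp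
  rw [e, Real.log_div hL.ne' hnr]
  generalize (∑' k : ℕ, (L / n) ^ (k + 1) / ((k + 1 : ℝ) * (Nat.factorial (k + 1) : ℝ)) : ℝ) = S
  push_cast
  ring

lemma summable_ofReal_mul_moebius_div_pow (L : ℝ) (n : ℕ) :
    Summable fun k : ℕ =>
      ((L ^ (k + 1) / ((k + 1 : ℝ) * (Nat.factorial (k + 1) : ℝ)) : ℝ) : ℂ) *
        ((moebius n : ℂ) / (n : ℂ) ^ (k + 2)) := by
  refine (summable_pow_div_mul_factorial L).norm.of_norm_bounded fun k => ?_
  rw [norm_mul, Complex.norm_real]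
  refine mul_le_of_le_one_right (norm_nonneg _) ?_
  rcases eq_or_ne n 0 with rfl | hn
  · simp
  have hn1 : (1 : ℝ) ≤ n := by exact_mod_cast Nat.one_le_iff_ne_zero.mpr hn
  rw [norm_div, norm_pow, Complex.norm_natCast]
  refine div_le_one_of_le₀ (le_trans ?_ (one_le_pow₀ hn1)) (by positivity)
  rw [Complex.norm_intCast]
  exact_mod_cast abs_moebius_le_one

lemma tendsto_sum_tsum_moebius_div_pow (L : ℝ) :
    Tendsto (fun N : ℕ => ∑ n ∈ Finset.Icc 1 N, ∑' k : ℕ,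
      ((L ^ (k + 1) / ((k + 1 : ℝ) * (Nat.factorial (k + 1) : ℝ)) : ℝ) : ℂ) *
        ((moebius n : ℂ) / (n : ℂ) ^ (k + 2))) atTop
      (nhds (∑' k : ℕ, ((L ^ (k + 1) / ((k + 1 : ℝ) * (Nat.factorial (k + 1) : ℝ)) : ℝ) : ℂ) *
        (riemannZeta ((k : ℂ) + 2))⁻¹)) := by
  have e (N : ℕ) : ∑ n ∈ Finset.Icc 1 N, ∑' k : ℕ,
      ((L ^ (k + 1) / ((k + 1 : ℝ) * (Nat.factorial (k + 1) : ℝ)) : ℝ) : ℂ) *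
        ((moebius n : ℂ) / (n : ℂ) ^ (k + 2)) =
      ∑' k : ℕ, ((L ^ (k + 1) / ((k + 1 : ℝ) * (Nat.factorial (k + 1) : ℝ)) : ℝ) : ℂ) *
        ∑ n ∈ Finset.Icc 1 N, (moebius n : ℂ) / (n : ℂ) ^ (k + 2) := by
    rw [← Summable.tsum_finsetSum fun n _ => summable_ofReal_mul_moebius_div_pow L n]
    exact tsum_congr fun k => (Finset.mul_sum _ _ _).symm
  refine Tendsto.congr (fun N => (e N).symm) ?_
  refine tendsto_tsum_of_dominated_convergence
    (bound := fun k : ℕ => ‖L ^ (k + 1) / ((k + 1 : ℝ) * (Nat.factorial (k + 1) : ℝ))‖ *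
      ∑' n : ℕ, 1 / (n : ℝ) ^ 2)
    ?_ (fun k => ?_) (Eventually.of_forall fun N k => ?_)
  · exact (summable_pow_div_mul_factorial L).norm.mul_right _
  · exact (tendsto_sum_moebius_div_pow k).const_mul _
  · rw [norm_mul, Complex.norm_real]
    exact mul_le_mul_of_nonneg_left (norm_sum_moebius_div_pow_le k N) (norm_nonneg _)

lemma summable_gramTerm (L : ℝ) :
    Summable fun k : ℕ => ((L ^ (k + 1) / ((k + 1 : ℝ) * (Nat.factorial (k + 1) : ℝ)) : ℝ) : ℂ) *
        (riemannZeta ((k : ℂ) + 2))⁻¹ := by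
  refine ((summable_pow_div_mul_factorial L).norm.mul_right
    (∑' n : ℕ, 1 / (n : ℝ) ^ 2)).of_norm_bounded fun k => ?_
  rw [norm_mul, Complex.norm_real]
  gcongr
  exact le_of_tendsto (tendsto_sum_moebius_div_pow k).norm
    (Eventually.of_forall fun N => norm_sum_moebius_div_pow_le k N)

/-- Gram's formula: for x > 1, the Gram series 1 + Σ_{n≥1} (log x)^n / (n ζ(n+1) n!)
equals lim_{N→∞} Σ_{n=1}^N (μ(n)/n) li(x^{1/n}), where li(x^{1/n}) is given by its
convergent series γ + log((log x)/n) + Σ_{k≥1} ((log x)/n)^k / (k·k!); in particular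
both the Gram series and the limit exist. -/
theorem gram_formula :
    ∀ x : ℝ, 1 < x →
    ∃ G : ℂ,
      HasSum (fun n : ℕ =>
          ((Real.log x : ℂ)) ^ (n + 1) /
            ((n + 1 : ℂ) * riemannZeta ((n : ℂ) + 2) * (Nat.factorial (n + 1) : ℂ)))
        (G - 1) ∧
      Tendsto (fun N : ℕ => ∑ n ∈ Finset.Icc 1 N,
          ((moebius n : ℂ) / (n : ℂ)) *
            ((Real.eulerMascheroniConstant + Real.log (Real.log x / n) +
              ∑' k : ℕ, (Real.log x / n) ^ (k + 1) /
                ((k + 1 : ℝ) * (Nat.factorial (k + 1) : ℝ)) : ℝ) : ℂ))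
        atTop (nhds G) := by
  intro x hx
  have hL : 0 < Real.log x := Real.log_pos hx
  set L := Real.log x
  refine ⟨1 + ∑' k : ℕ, ((L ^ (k + 1) / ((k + 1 : ℝ) * (Nat.factorial (k + 1) : ℝ)) : ℝ) : ℂ) *
        (riemannZeta ((k : ℂ) + 2))⁻¹, ?_, ?_⟩
  · rw [add_sub_cancel_left]
    convert (summable_gramTerm L).hasSum using 2 with k
    push_cast
    rw [mul_right_comm, ← div_div, div_eq_mul_inv _ (riemannZeta _)]
  · have h1 := ((tendsto_sum_moebius_div.const_mul
      ((Real.eulerMascheroniConstant + Real.log L : ℝ) : ℂ)).sub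
      tendsto_sum_moebius_mul_log_div).add (tendsto_sum_tsum_moebius_div_pow L)
    rw [mul_zero, zero_sub, neg_neg] at h1
    refine h1.congr fun N => ?_
    rw [Finset.mul_sum, ← Finset.sum_sub_distrib, ← Finset.sum_add_distrib]
    refine Finset.sum_congr rfl fun n hn => ?_
    rw [Finset.mem_Icc] at hn
    exact (moebius_div_mul_li_eq hL (by omega) _).symm
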